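/- arXiv:2009.08226 — 7 statements merged into one kernel-verified Lean document; each statement's English description precedes it below -/
import Mathlib

section
/- For every real number c > 0 and every prime p with p ≥ 3/c, there exists a finite p-group G together with a normal abelian subgroup N of G such that o(G) < o(N)^c. -/
/-- The average order of the elements of a group `G`:
`o(G) = (∑_{g ∈ G} |g|) / |G|`, as a real number. -/
noncomputable def avgOrder (G : Type*) [Group G] : ℝ :=
  (∑ᶠ g : G, (orderOf g : ℝ)) / (Nat.card G)

open Finset

section AverageOrder

lemma avgOrder_eq_sum (G : Type*) [Group G] [Fintype G] :
    avgOrder G = (∑ g : G, (orderOf g : ℝ)) / Nat.card G := by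
  rw [avgOrder, finsum_eq_sum_of_fintype]

lemma avgOrder_le_of_surjective {G H : Type*} [Group G] [Finite G] [Group H] (ψ : G →* H)
    (hψ : Function.Surjective ψ) {a b : ℕ} (ha : ∀ g : G, ψ g ≠ 1 → orderOf g ≤ a)
    (hb : ∀ g : G, orderOf g ≤ b) : avgOrder G ≤ a + b / Nat.card H := by
  classical
  have := Fintype.ofFinite G
  have : Finite H := Finite.of_surjective ψ hψ
  have hG : (0 : ℝ) < Nat.card G := by exact_mod_cast Nat.card_pos
  have hH : (0 : ℝ) < Nat.card H := by exact_mod_cast Nat.card_pos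
  have hker : (Nat.card ψ.ker : ℝ) * Nat.card H = Nat.card G := by
    rw [← Nat.card_congr (QuotientGroup.quotientKerEquivOfSurjective ψ hψ).toEquiv]
    exact_mod_cast Subgroup.card_mul_index ψ.ker
  have hsum : ∑ g : G, (if ψ g = 1 then (b : ℝ) else 0) = Nat.card ψ.ker * b := by
    rw [← Finset.sum_filter, Finset.sum_const, nsmul_eq_mul, ← Fintype.card_subtype,
      ← Nat.card_eq_fintype_card]
    rfl
  rw [avgOrder_eq_sum, div_le_iff₀ hG]
  calc ∑ g : G, (orderOf g : ℝ) ≤ ∑ g : G, ((a : ℝ) + if ψ g = 1 then (b : ℝ) else 0) := by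
        refine Finset.sum_le_sum fun g _ ↦ ?_
        split_ifs with h
        · exact (Nat.cast_le.2 (hb g)).trans (le_add_of_nonneg_left a.cast_nonneg)
        · simpa using ha g h
    _ = (a + b / Nat.card H) * Nat.card G := by
        rw [Finset.sum_add_distrib, hsum, Finset.sum_const, nsmul_eq_mul, Finset.card_univ,
          ← Nat.card_eq_fintype_card, ← hker]
        field_simp

lemma half_le_avgOrder {A : Type*} [Group A] [Finite A] (hcomm : ∀ x y : A, x * y = y * x)
    {m k : ℕ} (hm : ∀ x : A, x ^ m ≠ 1 → k ≤ orderOf x) {a : A} (ha : a ^ m ≠ 1) :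
    (k : ℝ) / 2 ≤ avgOrder A := by
  classical
  have := Fintype.ofFinite A
  have hA : (0 : ℝ) < Nat.card A := by exact_mod_cast Nat.card_pos
  let f : A →* A := ⟨⟨fun x ↦ x ^ m, one_pow m⟩, fun x y ↦ Commute.mul_pow (hcomm x y) m⟩
  have hf : 2 * Nat.card f.ker ≤ Nat.card A := by
    rw [← Subgroup.card_mul_index f.ker, mul_comm]
    refine Nat.mul_le_mul_left _ ?_
    have h1 : f.ker.index ≠ 1 := fun h ↦ ha <| by
      have : a ∈ f.ker := Subgroup.index_eq_one.1 h ▸ Subgroup.mem_top a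
      exact this
    have h0 : f.ker.index ≠ 0 := Subgroup.index_ne_zero_of_finite
    omega
  have hsum : ∑ g : A, (if g ^ m = 1 then (k : ℝ) else 0) = Nat.card f.ker * k := by
    rw [← Finset.sum_filter, Finset.sum_const, nsmul_eq_mul, ← Fintype.card_subtype,
      ← Nat.card_eq_fintype_card]
    rfl
  have hle : ∑ g : A, ((k : ℝ) - if g ^ m = 1 then (k : ℝ) else 0) ≤ ∑ g : A, (orderOf g : ℝ) := by
    refine Finset.sum_le_sum fun g _ ↦ ?_
    split_ifs with h
    · simp
    · simpa using hm g h
  rw [Finset.sum_sub_distrib, hsum, Finset.sum_const, nsmul_eq_mul, Finset.card_univ,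
    ← Nat.card_eq_fintype_card] at hle
  have hf' : (2 : ℝ) * Nat.card f.ker ≤ Nat.card A := by exact_mod_cast hf
  rw [avgOrder_eq_sum, le_div_iff₀ hA]
  nlinarith [(k.cast_nonneg : (0 : ℝ) ≤ k)]

lemma one_lt_avgOrder (G : Type*) [Group G] [Finite G] [Nontrivial G] : 1 < avgOrder G := by
  have := Fintype.ofFinite G
  have hG : (0 : ℝ) < Nat.card G := by exact_mod_cast Nat.card_pos
  obtain ⟨g, hg⟩ := exists_ne (1 : G)
  rw [avgOrder_eq_sum, lt_div_iff₀ hG, one_mul, Nat.card_eq_fintype_card, ← Finset.card_univ,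
    ← nsmul_one, ← Finset.sum_const]
  refine Finset.sum_lt_sum (fun g _ ↦ by exact_mod_cast orderOf_pos g) ⟨g, mem_univ g, ?_⟩
  have h1 := orderOf_pos g
  have h2 : orderOf g ≠ 1 := fun h ↦ hg (orderOf_eq_one_iff.1 h)
  exact_mod_cast (by omega : 1 < orderOf g)

lemma avgOrder_congr {G H : Type*} [Group G] [Group H] (e : G ≃* H) : avgOrder G = avgOrder H := by
  rw [avgOrder, avgOrder, Nat.card_congr e.toEquiv]
  congr 1
  exact finsum_eq_of_bijective e e.bijective fun g ↦ by rw [e.orderOf_eq]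

end AverageOrder

namespace RegularWreathProduct

variable {D Q : Type*} [CommGroup D] [Group Q]

lemma pow_right (w : D ≀ᵣ Q) (k : ℕ) : (w ^ k).right = w.right ^ k :=
  map_pow (rightHom : D ≀ᵣ Q →* Q) w k

lemma pow_left (w : D ≀ᵣ Q) (k : ℕ) (x : Q) :
    (w ^ k).left x = ∏ i ∈ range k, w.left (w.right⁻¹ ^ i * x) := by
  induction k generalizing x with
  | zero => simp
  | succ k ih =>
    rw [pow_succ', mul_left, Pi.mul_apply, ih, prod_range_succ']
    simp [pow_succ, mul_assoc, mul_comm]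

/-- The elements of `D ≀ᵣ Q` whose first component has product `1` on each coset of the central
subgroup `Z`. -/
def normOne (D : Type*) [CommGroup D] (Z : Subgroup Q) [Fintype Z] (hZ : Z ≤ Subgroup.center Q) :
    Subgroup (D ≀ᵣ Q) where
  carrier := {w | ∀ x, ∏ c : Z, w.left (c * x) = 1}
  one_mem' := by simp
  mul_mem' := by
    intro a b ha hb x
    have h (c : Z) : a.right⁻¹ * (c * x) = c * (a.right⁻¹ * x) := by
      rw [← mul_assoc, ← mul_assoc, Subgroup.mem_center_iff.1 (hZ c.2)]
    simp only [mul_left, Pi.mul_apply, prod_mul_distrib, h]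
    rw [ha, hb, one_mul]
  inv_mem' := by
    intro a ha x
    have h (c : Z) : a.right * (c * x) = c * (a.right * x) := by
      rw [← mul_assoc, ← mul_assoc, Subgroup.mem_center_iff.1 (hZ c.2)]
    simp only [inv_left, Pi.inv_apply, prod_inv_distrib, h]
    rw [ha, inv_one]

variable {Z : Subgroup Q} [Fintype Z] {hZ : Z ≤ Subgroup.center Q}

lemma mem_normOne {w : D ≀ᵣ Q} : w ∈ normOne D Z hZ ↔ ∀ x, ∏ c : Z, w.left (c * x) = 1 := Iff.rfl

lemma pow_prime_eq_one_of_mem_normOne {p : ℕ} [Fact p.Prime] (hp : Nat.card Z = p)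
    {w : D ≀ᵣ Q} (hw : w ∈ normOne D Z hZ) (hwZ : w.right ∈ Z) (h1 : w.right ≠ 1) : w ^ p = 1 := by
  classical
  let y : Z := ⟨w.right, hwZ⟩⁻¹
  have hy : y ≠ 1 := by simpa [y, Subtype.ext_iff] using h1
  have hyp : orderOf y = p := orderOf_eq_prime (hp ▸ pow_card_eq_one') hy
  have hinj : Set.InjOn (fun i ↦ y ^ i) (range p : Set ℕ) := by
    intro i hi j hj h
    exact pow_injOn_Iio_orderOf (by simpa [hyp] using hi) (by simpa [hyp] using hj) h
  have himage : (range p).image (fun i ↦ y ^ i) = univ := by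
    refine Finset.eq_univ_of_card _ ?_
    rw [Finset.card_image_of_injOn hinj, card_range, ← Nat.card_eq_fintype_card, hp]
  ext x
  · rw [pow_left, one_left, Pi.one_apply, ← hw x, ← himage, Finset.prod_image hinj]
    simp [y]
  · rw [pow_right, one_right]
    exact congrArg Subtype.val (hp ▸ pow_card_eq_one' : (⟨w.right, hwZ⟩ : Z) ^ p = 1)

lemma exists_mem_normOne_left_one_eq [Nontrivial Z] (g : D) :
    ∃ w ∈ normOne D Z hZ, w.right = 1 ∧ w.left 1 = g := by
  classical
  obtain ⟨z, hz⟩ := exists_ne (1 : Z)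
  let f : Q → D := Pi.mulSingle 1 g
  refine ⟨⟨fun x ↦ f x / f (z * x), 1⟩, fun x ↦ ?_, rfl, ?_⟩
  · have := Fintype.prod_equiv (Equiv.mulLeft z) (fun c : Z ↦ f (z * (c * x)))
      (fun c : Z ↦ f (c * x)) (fun c ↦ by simp [mul_assoc])
    simp [prod_div_distrib, this]
  · have : (z : Q) ≠ 1 := by simpa using hz
    simp [f, Pi.mulSingle_eq_of_ne this]

end RegularWreathProduct

section Construction

variable {p : ℕ} [Fact p.Prime]

lemma exists_avgOrder_bounds {Q H : Type} [Group Q] [Finite Q] [Group H] {Z : Subgroup Q}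
    (hZ : Z ≤ Subgroup.center Q) (hZp : Nat.card Z = p) (ψ : Q →* H)
    (hψ : Function.Surjective ψ) (hH : Nat.card H = p ^ p) (hpow : ∀ q, q ^ p ∈ Z)
    (hker : ∀ q, q ^ p = 1 ↔ ψ q = 1) :
    ∃ (G : Type) (_ : Group G) (_ : Finite G), IsPGroup p G ∧
      ∃ N : Subgroup G, N.Normal ∧ (∀ x ∈ N, ∀ y ∈ N, x * y = y * x) ∧
        avgOrder G ≤ p ^ 2 + p ∧ (p ^ p : ℝ) / 2 ≤ avgOrder N := by
  have := Fintype.ofFinite Z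
  have hp : p.Prime := Fact.out
  have : Nontrivial Z := Finite.one_lt_card_iff_nontrivial.1 (hZp ▸ hp.one_lt)
  have : NeZero (p ^ p) := ⟨pow_ne_zero _ hp.ne_zero⟩
  let D := Multiplicative (ZMod (p ^ p))
  have hD (d : D) : d ^ p ^ p = 1 := by
    simpa only [show Nat.card D = p ^ p from Nat.card_zmod _] using pow_card_eq_one' (x := d)
  let G := RegularWreathProduct.normOne D Z hZ
  let ρ : G →* Q := RegularWreathProduct.rightHom.comp G.subtype
  have hρ (g : G) : ρ g = g.1.right := rfl
  have hN (g : G) (hg : ρ g = 1) (k : ℕ) (x : Q) : (g ^ k).1.left x = g.1.left x ^ k := by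
    rw [Subgroup.coe_pow, RegularWreathProduct.pow_left, ← hρ, hg]
    simp
  have hext (g : G) (hg : ρ g = 1) (h : ∀ x, g.1.left x = 1) : g = 1 :=
    Subtype.ext <| RegularWreathProduct.ext (funext h) hg
  have hexp (g : G) (hg : ρ g = 1) : g ^ p ^ p = 1 :=
    hext _ (by rw [map_pow, hg, one_pow]) fun x ↦ by rw [hN g hg, hD]
  have hsq (g : G) (hg : ρ g ^ p ≠ 1) : g ^ p ^ 2 = 1 := by
    rw [sq, pow_mul]
    refine Subtype.ext ?_
    have hr : (g ^ p).1.right = ρ g ^ p := by rw [← hρ, map_pow]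
    exact RegularWreathProduct.pow_prime_eq_one_of_mem_normOne hZp (g ^ p).2 (hr ▸ hpow _)
      (hr ▸ hg)
  have hall (g : G) : g ^ p ^ (p + 1) = 1 := by
    by_cases hg : ρ g ^ p = 1
    · rw [pow_succ', pow_mul]
      exact hexp _ (by rw [map_pow, hg])
    · rw [← Nat.sub_add_cancel (show 2 ≤ p + 1 by linarith [hp.two_le]), pow_add, mul_comm,
        pow_mul, hsq g hg, one_pow]
  have hcomm (x : G) (hx : ρ x = 1) (y : G) (hy : ρ y = 1) : x * y = y * x := by
    rw [hρ] at hx hy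
    refine Subtype.ext (RegularWreathProduct.ext (funext fun t ↦ ?_) ?_)
    · simp [hx, hy, mul_comm]
    · simp [hx, hy]
  refine ⟨G, inferInstance, inferInstance, fun g ↦ ⟨p + 1, hall g⟩, ρ.ker,
    inferInstance, hcomm, ?_, ?_⟩
  · have hρs : Function.Surjective ρ := fun q ↦
      ⟨⟨RegularWreathProduct.inl q, by simp [RegularWreathProduct.mem_normOne, G]⟩, rfl⟩
    refine (avgOrder_le_of_surjective (ψ.comp ρ) (hψ.comp hρs) (a := p ^ 2) (b := p ^ (p + 1))
      (fun g hg ↦ ?_) fun g ↦ ?_).trans_eq ?_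
    · exact Nat.le_of_dvd (pow_pos hp.pos _)
        (orderOf_dvd_of_pow_eq_one (hsq g fun h ↦ hg ((hker _).1 h)))
    · exact Nat.le_of_dvd (pow_pos hp.pos _) (orderOf_dvd_of_pow_eq_one (hall g))
    · have : (p : ℝ) ≠ 0 := by exact_mod_cast hp.ne_zero
      rw [hH]
      push_cast
      field_simp
      ring
  · let γ : D := Multiplicative.ofAdd 1
    have hγ : γ ^ p ^ (p - 1) ≠ 1 := by
      intro h
      have h' : ((p ^ (p - 1) : ℕ) : ZMod (p ^ p)) = 0 := by
        simpa [γ, D, ← ofAdd_nsmul] using h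
      rw [ZMod.natCast_eq_zero_iff, Nat.pow_dvd_pow_iff_le_right hp.one_lt] at h'
      have := hp.pos
      omega
    obtain ⟨w, hw, hw1, hwγ⟩ := RegularWreathProduct.exists_mem_normOne_left_one_eq (hZ := hZ) γ
    have hbound := half_le_avgOrder (A := ρ.ker) (m := p ^ (p - 1)) (k := p ^ p)
      (fun x y ↦ Subtype.ext (hcomm x x.2 y y.2)) (fun x hx ↦ ?_) (a := ⟨⟨w, hw⟩, hw1⟩) ?_
    · exact_mod_cast hbound
    · have hxp : x ^ p ^ (p - 1 + 1) = 1 := by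
        rw [Nat.sub_add_cancel hp.one_le]
        exact Subtype.ext (hexp x x.2)
      rw [orderOf_eq_prime_pow hx hxp, Nat.sub_add_cancel hp.one_le]
    · intro h
      apply hγ
      rw [← hwγ, ← hN ⟨w, hw⟩ hw1]
      exact congrArg (fun t : ρ.ker ↦ t.1.1.left 1) h

end Construction

section NormForm

variable {p : ℕ} [Fact p.Prime] {K : Type*} [Field K] [CharP K p]

lemma sum_range_natCast_pow (k : ℕ) (hk : k < p) :
    ∑ i ∈ range p, (i : K) ^ k = if k = p - 1 then -1 else 0 := by
  have hp : p.Prime := Fact.out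
  have h : ∑ i ∈ range p, (i : K) ^ k = ZMod.castHom dvd_rfl K (∑ i : ZMod p, i ^ k) := by
    rw [map_sum]
    refine Finset.sum_bij' (fun i _ ↦ (i : ZMod p)) (fun i _ ↦ i.val) ?_ ?_ ?_ ?_ ?_
    · simp
    · simp [ZMod.val_lt]
    · intro i hi
      exact ZMod.val_cast_of_lt (mem_range.1 hi)
    · simp
    · simp
  rw [h]
  split_ifs with hkp
  · subst hkp
    have (i : ZMod p) : i ^ (p - 1) = 1 - if i = 0 then 1 else 0 := by
      split_ifs with hi
      · simp [hi, Nat.sub_ne_zero_of_lt hp.one_lt]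
      · simp [ZMod.pow_card_sub_one_eq_one hi]
    simp [this]
  · rw [FiniteField.sum_pow_lt_card_sub_one, map_zero]
    rw [ZMod.card]
    omega

lemma sum_range_prod_add_natCast_mul {ι : Type*} (s : Finset ι) (hs : #s = p - 1) (a b : ι → K) :
    ∑ i ∈ range p, ∏ j ∈ s, (i * b j + a j) = -∏ j ∈ s, b j := by
  classical
  have hp : p.Prime := Fact.out
  simp only [prod_add, prod_mul_distrib, prod_const]
  rw [sum_comm]
  have h (t) (ht : t ∈ s.powerset) :
      ∑ i ∈ range p, (i : K) ^ #t * (∏ j ∈ t, b j) * ∏ j ∈ s \ t, a j =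
        if t = s then -∏ j ∈ s, b j else 0 := by
    have hts := mem_powerset.1 ht
    have hcard : #t = p - 1 ↔ t = s :=
      ⟨fun h ↦ eq_of_subset_of_card_le hts (by rw [hs, h]), fun h ↦ h ▸ hs⟩
    have := card_le_card hts
    have := hp.pos
    simp only [mul_assoc]
    rw [← sum_mul, sum_range_natCast_pow _ (by omega)]
    simp only [hcard]
    split_ifs with h
    · simp [h]
    · simp
  rw [sum_congr rfl h]
  simp

lemma sum_range_nsmul_add_pow (d x : K) :
    ∑ i ∈ range p, (i • d + x) ^ (∑ j ∈ range (p - 1), p ^ (j + 1)) =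
      -d ^ (∑ j ∈ range (p - 1), p ^ (j + 1)) := by
  simp only [← prod_pow_eq_pow_sum]
  rw [← sum_range_prod_add_natCast_mul (p := p) _ (card_range _) (fun j ↦ x ^ p ^ (j + 1))]
  refine sum_congr rfl fun i _ ↦ prod_congr rfl fun j _ ↦ ?_
  have : (i : K) ^ p ^ (j + 1) = i := by
    have := congrArg (ZMod.castHom dvd_rfl K) (ZMod.pow_card_pow (n := j + 1) (i : ZMod p))
    rwa [map_pow, map_natCast] at this
  rw [add_pow_char_pow, nsmul_eq_mul, mul_pow, this]

open Multiplicative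

/-- The elements `(f, e)` of the wreath product of the additive group of a field with itself for
which every sum of `f` over a coset of an additive subgroup `⟨d⟩` is the prescribed multiple
`e * F d`. -/
def sumSubgroup (K : Type*) [Field K] (p : ℕ) (F : K → K) :
    Subgroup (Multiplicative K ≀ᵣ Multiplicative K) where
  carrier := {w | ∀ d x : K,
    ∑ i ∈ range p, (w.left (ofAdd (i • d + x))).toAdd = w.right.toAdd * F d}
  one_mem' := by simp
  mul_mem' := by
    intro a b ha hb d x
    have h (i : ℕ) : a.right⁻¹ * ofAdd (i • d + x) = ofAdd (i • d + (x - a.right.toAdd)) := by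
      apply toAdd.injective
      simp only [toAdd_mul, toAdd_inv, toAdd_ofAdd]
      ring
    simp only [RegularWreathProduct.mul_left, Pi.mul_apply, toAdd_mul, sum_add_distrib, h,
      RegularWreathProduct.mul_right, add_mul]
    rw [ha, hb]
  inv_mem' := by
    intro a ha d x
    have h (i : ℕ) : a.right * ofAdd (i • d + x) = ofAdd (i • d + (x + a.right.toAdd)) := by
      apply toAdd.injective
      simp only [toAdd_mul, toAdd_ofAdd]
      ring
    simp only [RegularWreathProduct.inv_left, Pi.inv_apply, toAdd_inv, sum_neg_distrib, h,
      RegularWreathProduct.inv_right, neg_mul]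
    rw [ha]

lemma exists_prime_pow_eq_one_iff (p : ℕ) [Fact p.Prime] :
    ∃ (Q H : Type) (_ : Group Q) (_ : Finite Q) (_ : Group H) (Z : Subgroup Q) (ψ : Q →* H),
      Z ≤ Subgroup.center Q ∧ Nat.card Z = p ∧ Function.Surjective ψ ∧ Nat.card H = p ^ p ∧
      (∀ q : Q, q ^ p ∈ Z) ∧ ∀ q : Q, q ^ p = 1 ↔ ψ q = 1 := by
  have hp : p.Prime := Fact.out
  let K := GaloisField p p
  let m := ∑ j ∈ range (p - 1), p ^ (j + 1)
  have hm : m + 1 = ∑ j ∈ range (Module.finrank (ZMod p) K), Nat.card (ZMod p) ^ j := by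
    rw [GaloisField.finrank p hp.ne_zero, Nat.card_zmod]
    simpa only [pow_zero, Nat.sub_add_cancel hp.one_le] using
      (sum_range_succ' (fun j ↦ p ^ j) (p - 1)).symm
  let Q := sumSubgroup K p fun d ↦ -d ^ m
  let ψ : Q →* Multiplicative K := RegularWreathProduct.rightHom.comp Q.subtype
  let z : Q := ⟨⟨fun _ ↦ ofAdd 1, 1⟩, fun d x ↦ by simp⟩
  have hz_left (k : ℕ) (x) : (z ^ k).1.left x = ofAdd (k : K) := by
    rw [Subgroup.coe_pow, RegularWreathProduct.pow_left]
    simp [z, ← ofAdd_nsmul]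
  have hz_right (k : ℕ) : (z ^ k).1.right = 1 := by
    rw [Subgroup.coe_pow, RegularWreathProduct.pow_right]
    simp [z]
  have hQp (q : Q) : q ^ p = z ^ (Algebra.norm (ZMod p) (-(ψ q).toAdd)).val := by
    refine Subtype.ext (RegularWreathProduct.ext (funext fun x ↦ ?_) ?_)
    · rw [hz_left, Subgroup.coe_pow, RegularWreathProduct.pow_left]
      apply toAdd.injective
      have hq := q.2 (-(ψ q).toAdd) x.toAdd
      have hnorm := FiniteField.algebraMap_norm_eq_pow_sum (ZMod p) K (-(ψ q).toAdd)
      rw [toAdd_prod, toAdd_ofAdd]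
      refine (hq.trans ?_).trans (Eq.trans hnorm.symm ?_)
      · rw [← hm, pow_succ']
        change (ψ q).toAdd * _ = _
        ring
      · conv_lhs => rw [← ZMod.natCast_zmod_val (Algebra.norm (ZMod p) (-(ψ q).toAdd))]
        rw [map_natCast]
    · rw [hz_right, Subgroup.coe_pow, RegularWreathProduct.pow_right]
      apply toAdd.injective
      simp [toAdd_pow]
  have hz1 : z ≠ 1 := fun h ↦ by
    have := congrArg (fun t : Q ↦ (t.1.left 1).toAdd) h
    simp [z] at this
  have hzp : orderOf z = p := by
    refine orderOf_eq_prime ?_ hz1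
    rw [hQp]
    simp [ψ, z, RegularWreathProduct.rightHom]
  refine ⟨Q, Multiplicative K, inferInstance, inferInstance, inferInstance, Subgroup.zpowers z, ψ,
    ?_, ?_, ?_, ?_, fun q ↦ ?_, fun q ↦ ?_⟩
  · rw [Subgroup.zpowers_le, Subgroup.mem_center_iff]
    intro q
    refine Subtype.ext (RegularWreathProduct.ext (funext fun x ↦ ?_) ?_)
    · simp [z, mul_comm]
    · simp [z]
  · rw [Nat.card_zpowers, hzp]
  · intro e
    refine ⟨⟨⟨fun x ↦ ofAdd (e.toAdd * x.toAdd ^ m), e⟩, fun d x ↦ ?_⟩, rfl⟩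
    simp only [toAdd_ofAdd, ← mul_sum]
    rw [sum_range_nsmul_add_pow]
  · exact GaloisField.card p p hp.ne_zero
  · rw [hQp]
    exact Subgroup.npow_mem_zpowers z _
  · rw [hQp, ← orderOf_dvd_iff_pow_eq_one, hzp, ← ZMod.natCast_eq_zero_iff, ZMod.natCast_zmod_val,
      Algebra.norm_eq_zero_iff, neg_eq_zero, toAdd_eq_zero]

end NormForm

/-- For every real `c > 0` and every prime `p` with `p ≥ 3/c`, there exists a
finite `p`-group `G` with a normal abelian subgroup `N` such that `o(G) < o(N)^c`. -/
theorem avgOrder_lt_rpow_of_prime_ge (c : ℝ) (hc : 0 < c) (p : ℕ) (hp : p.Prime)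
    (hpc : 3 / c ≤ (p : ℝ)) :
    ∃ (G : Type) (_ : Group G) (_ : Finite G), IsPGroup p G ∧
      ∃ N : Subgroup G, N.Normal ∧ (∀ x ∈ N, ∀ y ∈ N, x * y = y * x) ∧
        avgOrder G < avgOrder N ^ c := by
  have : Fact p.Prime := ⟨hp⟩
  rcases hp.two_le.eq_or_lt with rfl | hp3
  · have hc1 : 1 < c := by
      rw [div_le_iff₀ hc] at hpc
      push_cast at hpc
      linarith
    refine ⟨Multiplicative (ZMod 2), inferInstance, inferInstance,
      IsPGroup.of_card (n := 1) (by simp), ⊤, inferInstance,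
      fun x _ y _ ↦ mul_comm x y, ?_⟩
    rw [avgOrder_congr Subgroup.topEquiv]
    exact Real.self_lt_rpow_of_one_lt (one_lt_avgOrder _) hc1
  · obtain ⟨Q, H, _, _, _, Z, ψ, hZ, hZp, hψ, hH, hpow, hker⟩ := exists_prime_pow_eq_one_iff p
    obtain ⟨G, _, _, hG, N, hN, hcomm, hle, hge⟩ :=
      exists_avgOrder_bounds hZ hZp ψ hψ hH hpow hker
    refine ⟨G, inferInstance, inferInstance, hG, N, hN, hcomm, hle.trans_lt ?_⟩
    have hp3' : (3 : ℝ) ≤ p := by exact_mod_cast hp3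
    have hp0 : (0 : ℝ) < p := by linarith
    have hcp : 3 / (p : ℝ) ≤ c := by
      rw [div_le_iff₀ hc] at hpc
      rw [div_le_iff₀ hp0]
      linarith
    have h2 : (2 : ℝ) ^ (3 / (p : ℝ)) ≤ 2 := by
      conv_rhs => rw [← Real.rpow_one 2]
      exact Real.rpow_le_rpow_of_exponent_le one_le_two ((div_le_one hp0).2 hp3')
    have hpp : ((p : ℝ) ^ p) ^ (3 / (p : ℝ)) = p ^ 3 := by
      rw [← Real.rpow_natCast, ← Real.rpow_mul hp0.le, mul_div_cancel₀ _ hp0.ne']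
      norm_cast
    have hN1 : 1 ≤ avgOrder N := by
      have : (p : ℝ) ≤ p ^ p := le_self_pow₀ (by linarith) hp.ne_zero
      linarith
    calc (p : ℝ) ^ 2 + p < (p : ℝ) ^ 3 / 2 := by nlinarith [mul_nonneg (mul_pos hp0 hp0).le (sub_nonneg.2 hp3')]
      _ ≤ (p : ℝ) ^ 3 / 2 ^ (3 / (p : ℝ)) := by gcongr
      _ = ((p : ℝ) ^ p / 2) ^ (3 / (p : ℝ)) := by
        rw [Real.div_rpow (by positivity) zero_le_two, hpp]
      _ ≤ avgOrder N ^ (3 / (p : ℝ)) := Real.rpow_le_rpow (by positivity) hge (by positivity)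
      _ ≤ avgOrder N ^ c := Real.rpow_le_rpow_of_exponent_le hN1 hcp
end

section
/- For every real number c₁ > 0 there exists a finite group G such that o(G) < c₁ · mo(G)^{1/2}. (In particular, there is no constant c₁ > 0 with o(G) ≥ c₁ · mo(G)^{1/2} for all finite groups G.) -/
/-- The maximum order of an element of a finite group `G`. -/
noncomputable def maxOrder (G : Type*) [Group G] : ℕ :=
  ⨆ g : G, orderOf g

/-- The augmentation submodule of the group algebra of `ZMod p` over `ZMod n`, paired with
`ZMod p`; this is the underlying set of their semidirect product. -/
abbrev AugProd (p n : ℕ) [NeZero p] : Type :=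
  {f : ZMod p → ZMod n // ∑ x, f x = 0} × ZMod p

/-- The semidirect product of the augmentation submodule of the group algebra of `ZMod p`
over `ZMod n` by `ZMod p` acting by translation. -/
def AugSemidirect (p n : ℕ) [NeZero p] : Type := AugProd p n

namespace AugSemidirect

variable {p n : ℕ} [NeZero p]

/-- The element with a given module part and a given translation part. -/
def mk (f : ZMod p → ZMod n) (hf : ∑ x, f x = 0) (h : ZMod p) : AugSemidirect p n :=
  (⟨f, hf⟩, h)

/-- The module part of an element. -/
def fn (a : AugSemidirect p n) : ZMod p → ZMod n := a.1.1

/-- The translation part of an element. -/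
def shift (a : AugSemidirect p n) : ZMod p := a.2

theorem sum_fn (a : AugSemidirect p n) : ∑ x, a.fn x = 0 := a.1.2

@[ext]
theorem ext {a b : AugSemidirect p n} (h₁ : ∀ x, a.fn x = b.fn x) (h₂ : a.shift = b.shift) :
    a = b :=
  Prod.ext (Subtype.ext (funext h₁)) h₂

theorem sum_fn_add (a : AugSemidirect p n) (h : ZMod p) : ∑ x, a.fn (x + h) = 0 :=
  (Equiv.sum_comp (Equiv.addRight h) a.fn).trans a.sum_fn

instance : Mul (AugSemidirect p n) :=
  ⟨fun a b => mk (fun x => a.fn x + b.fn (x + a.shift))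
    (by rw [Finset.sum_add_distrib, sum_fn, sum_fn_add, add_zero]) (a.shift + b.shift)⟩

instance : One (AugSemidirect p n) := ⟨mk (fun _ => 0) (by simp) 0⟩

instance : Inv (AugSemidirect p n) :=
  ⟨fun a => mk (fun x => -a.fn (x + -a.shift))
    (by rw [Finset.sum_neg_distrib, sum_fn_add, neg_zero]) (-a.shift)⟩

@[simp] theorem mul_fn (a b : AugSemidirect p n) (x : ZMod p) :
    (a * b).fn x = a.fn x + b.fn (x + a.shift) := rfl
@[simp] theorem mul_shift (a b : AugSemidirect p n) : (a * b).shift = a.shift + b.shift := rfl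
@[simp] theorem one_fn (x : ZMod p) : (1 : AugSemidirect p n).fn x = 0 := rfl
@[simp] theorem one_shift : (1 : AugSemidirect p n).shift = 0 := rfl
@[simp] theorem inv_fn (a : AugSemidirect p n) (x : ZMod p) :
    a⁻¹.fn x = -a.fn (x + -a.shift) := rfl
@[simp] theorem inv_shift (a : AugSemidirect p n) : a⁻¹.shift = -a.shift := rfl

instance : Group (AugSemidirect p n) :=
  Group.ofLeftAxioms
    (fun a b c => by ext <;> simp [add_assoc])
    (fun a => by ext <;> simp)
    (fun a => by ext <;> simp)

theorem pow_shift (a : AugSemidirect p n) (k : ℕ) : (a ^ k).shift = k * a.shift := by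
  induction k with
  | zero => simp
  | succ k ih => rw [pow_succ, mul_shift, ih]; push_cast; ring

theorem pow_fn (a : AugSemidirect p n) (k : ℕ) (x : ZMod p) :
    (a ^ k).fn x = ∑ i ∈ Finset.range k, a.fn (x + i * a.shift) := by
  induction k with
  | zero => simp
  | succ k ih => rw [pow_succ, mul_fn, ih, pow_shift, Finset.sum_range_succ]

theorem pow_eq_one_of_shift_eq_zero {a : AugSemidirect p n} (ha : a.shift = 0) : a ^ n = 1 := by
  ext <;> simp [pow_fn, pow_shift, ha]

theorem sum_range_natCast {M : Type*} [AddCommMonoid M] (f : ZMod p → M) :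
    ∑ i ∈ Finset.range p, f i = ∑ y, f y := by
  refine Finset.sum_bij (fun i _ => (i : ZMod p)) (fun _ _ => Finset.mem_univ _) ?_ ?_
    (fun _ _ => rfl)
  · intro i hi j hj h
    have := congrArg ZMod.val h
    rwa [ZMod.val_cast_of_lt (Finset.mem_range.1 hi),
      ZMod.val_cast_of_lt (Finset.mem_range.1 hj)] at this
  · intro y _
    exact ⟨y.val, Finset.mem_range.2 y.val_lt, ZMod.natCast_zmod_val y⟩

theorem pow_eq_one_of_shift_ne_zero [Fact p.Prime] {a : AugSemidirect p n} (ha : a.shift ≠ 0) :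
    a ^ p = 1 := by
  ext x
  · rw [pow_fn, sum_range_natCast (fun y : ZMod p => a.fn (x + y * a.shift)), one_fn,
      ← a.sum_fn]
    exact Equiv.sum_comp ((Equiv.mulRight₀ a.shift ha).trans (Equiv.addLeft x)) a.fn
  · simp [pow_shift]

/-- `n` on the elements of the module, `1` elsewhere: up to a factor `p`, a multiple of
the order. -/
def weight (a : AugSemidirect p n) : ℕ := if a.shift = 0 then n else 1

theorem pow_prime_mul_weight [Fact p.Prime] (a : AugSemidirect p n) :
    a ^ (p * a.weight) = 1 := by
  unfold weight
  split_ifs with h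
  · rw [mul_comm, pow_mul, pow_eq_one_of_shift_eq_zero h, one_pow]
  · rw [mul_one, pow_eq_one_of_shift_ne_zero h]

instance [NeZero n] : Fintype (AugSemidirect p n) :=
  inferInstanceAs (Fintype (AugProd p n))

theorem prime_mul_sum_weight [NeZero n] :
    p * ∑ a : AugSemidirect p n, a.weight
      = Fintype.card (AugSemidirect p n) * (n + (p - 1)) := by
  have hw : ∑ h : ZMod p, (if h = 0 then n else 1) = n + (p - 1) := by
    rw [← Finset.add_sum_erase _ _ (Finset.mem_univ (0 : ZMod p)), if_pos rfl,
      Finset.sum_congr rfl (fun h hh => if_neg (Finset.ne_of_mem_erase hh)),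
      Finset.sum_const, Finset.card_erase_of_mem (Finset.mem_univ _), Finset.card_univ, ZMod.card,
      smul_eq_mul, mul_one]
  have hs : ∑ a : AugSemidirect p n, a.weight
      = ∑ a : AugProd p n, (if a.2 = 0 then n else 1) := rfl
  have hc : Fintype.card (AugSemidirect p n) = Fintype.card (AugProd p n) := rfl
  rw [hs, hc, Fintype.sum_prod_type, Fintype.card_prod, ZMod.card]
  simp only [hw, Finset.sum_const, Finset.card_univ, smul_eq_mul]
  ring

theorem exists_orderOf_eq (hp : 1 < p) : ∃ a : AugSemidirect p n, orderOf a = n := by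
  have : Fact (1 < p) := ⟨hp⟩
  let f : ZMod p → ZMod n := fun x => (if x = 0 then 1 else 0) - (if x = 1 then 1 else 0)
  have hf : ∑ x, f x = 0 := by simp [f]
  refine ⟨mk f hf 0, Nat.dvd_antisymm (orderOf_dvd_of_pow_eq_one
    (pow_eq_one_of_shift_eq_zero rfl)) ?_⟩
  rw [← CharP.cast_eq_zero_iff (ZMod n)]
  have h := congrArg (fun a => fn a 0) (pow_orderOf_eq_one (mk f hf 0))
  simp only [pow_fn, one_fn] at h
  simpa [mk, fn, shift, f] using h

end AugSemidirect

theorem le_maxOrder {G : Type*} [Group G] [Finite G] (g : G) : orderOf g ≤ maxOrder G :=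
  le_ciSup (f := fun g : G => orderOf g) (Set.finite_range _).bddAbove g

open AugSemidirect in
theorem sum_orderOf_prod_le {p l m n : ℕ} [Fact p.Prime] [NeZero l] [NeZero m] [NeZero n] :
    ∑ g : AugSemidirect p l × AugSemidirect p m × AugSemidirect p n, orderOf g ≤
      p * ((∑ a : AugSemidirect p l, a.weight) * ((∑ b : AugSemidirect p m, b.weight) *
        ∑ c : AugSemidirect p n, c.weight)) := by
  have hle (g : AugSemidirect p l × AugSemidirect p m × AugSemidirect p n) :
      orderOf g ≤ p * (g.1.weight * (g.2.1.weight * g.2.2.weight)) := by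
    have pos {k : ℕ} [NeZero k] (a : AugSemidirect p k) : 0 < a.weight := by
      unfold weight
      split_ifs
      exacts [NeZero.pos k, one_pos]
    refine orderOf_le_of_pow_eq_one (Nat.mul_pos (Fact.out : p.Prime).pos
      (Nat.mul_pos (pos _) (Nat.mul_pos (pos _) (pos _)))) ?_
    obtain ⟨a, b, c⟩ := g
    have pow_one_of_dvd {k j : ℕ} {a : AugSemidirect p k} (h : p * a.weight ∣ j) : a ^ j = 1 :=
      orderOf_dvd_iff_pow_eq_one.1
        ((orderOf_dvd_of_pow_eq_one a.pow_prime_mul_weight).trans h)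
    refine Prod.ext (pow_one_of_dvd ?_) (Prod.ext (pow_one_of_dvd ?_) (pow_one_of_dvd ?_))
    · exact mul_dvd_mul_left _ (Dvd.intro _ rfl)
    · exact mul_dvd_mul_left _ ((Dvd.intro _ rfl).trans (Dvd.intro_left _ rfl))
    · exact mul_dvd_mul_left _ ((Dvd.intro_left _ rfl).trans (Dvd.intro_left _ rfl))
  refine (Finset.sum_le_sum fun g _ => hle g).trans_eq ?_
  simp only [Fintype.sum_prod_type, ← Finset.mul_sum, ← Finset.sum_mul]

open AugSemidirect in
theorem mul_le_maxOrder_prod {p l m n : ℕ} [Fact p.Prime] [NeZero l] [NeZero m] [NeZero n]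
    (hlm : l.Coprime m) (hln : l.Coprime n) (hmn : m.Coprime n) :
    l * (m * n) ≤ maxOrder (AugSemidirect p l × AugSemidirect p m × AugSemidirect p n) := by
  have hp : 1 < p := (Fact.out : p.Prime).one_lt
  obtain ⟨a, ha⟩ := exists_orderOf_eq (n := l) hp
  obtain ⟨b, hb⟩ := exists_orderOf_eq (n := m) hp
  obtain ⟨c, hc⟩ := exists_orderOf_eq (n := n) hp
  have h := le_maxOrder (a, b, c)
  rwa [Prod.orderOf_mk, Prod.orderOf_mk, ha, hb, hc, hmn.lcm_eq_mul,
    (hlm.mul_right hln).lcm_eq_mul] at h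

theorem avgOrder_prod_le {p : ℕ} [Fact p.Prime] :
    avgOrder (AugSemidirect p p × AugSemidirect p (p + 1) × AugSemidirect p (2 * p + 1))
      ≤ 12 * p := by
  have hp : 0 < p := (Fact.out : p.Prime).pos
  have hweight {n k : ℕ} [NeZero n] (h : n + (p - 1) ≤ k * p) :
      ∑ a : AugSemidirect p n, a.weight ≤ k * Fintype.card (AugSemidirect p n) := by
    refine Nat.le_of_mul_le_mul_left ?_ hp
    rw [AugSemidirect.prime_mul_sum_weight]
    exact (Nat.mul_le_mul_left _ h).trans_eq (by ring)
  have h₁ := hweight (n := p) (k := 2) (by omega)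
  have h₂ := hweight (n := p + 1) (k := 2) (by omega)
  have h₃ := hweight (n := 2 * p + 1) (k := 3) (by omega)
  have key := sum_orderOf_prod_le.trans
    (Nat.mul_le_mul_left p (Nat.mul_le_mul h₁ (Nat.mul_le_mul h₂ h₃)))
  rw [avgOrder, finsum_eq_sum_of_fintype, Nat.card_eq_fintype_card,
    div_le_iff₀ (by exact_mod_cast Fintype.card_pos), Fintype.card_prod, Fintype.card_prod]
  norm_cast
  exact key.trans_eq (by ring)

theorem cube_le_maxOrder_prod {p : ℕ} [Fact p.Prime] :
    p ^ 3 ≤ maxOrder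
      (AugSemidirect p p × AugSemidirect p (p + 1) × AugSemidirect p (2 * p + 1)) := by
  refine le_trans ?_ (mul_le_maxOrder_prod (by simp) (by simp) ?_)
  · rw [pow_succ', sq]
    exact Nat.mul_le_mul_left _ (Nat.mul_le_mul (by omega) (by omega))
  · rw [show 2 * p + 1 = p + (p + 1) by ring]
    simp

/-- For every real `c₁ > 0` there exists a finite group `G` with
`o(G) < c₁ · mo(G)^(1/2)`, where `mo(G)` is the maximum order of an element of `G`.
In particular there is no constant `c₁ > 0` with `o(G) ≥ c₁ · mo(G)^(1/2)` for all
finite groups `G`. -/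
theorem exists_avgOrder_lt_mul_maxOrder_sqrt (c₁ : ℝ) (hc₁ : 0 < c₁) :
    ∃ (G : Type) (_ : Group G) (_ : Finite G),
      avgOrder G < c₁ * (maxOrder G : ℝ) ^ ((1 : ℝ) / 2) := by
  obtain ⟨p, hpN, hp⟩ := Nat.exists_infinite_primes (⌈144 / c₁ ^ 2⌉₊ + 1)
  have : Fact p.Prime := ⟨hp⟩
  refine ⟨AugSemidirect p p × AugSemidirect p (p + 1) × AugSemidirect p (2 * p + 1),
    inferInstance, inferInstance, avgOrder_prod_le.trans_lt ?_⟩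
  have hp0 : (0 : ℝ) < p := by exact_mod_cast hp.pos
  have hlt : 144 / c₁ ^ 2 < p := (Nat.le_ceil _).trans_lt (by exact_mod_cast hpN)
  rw [div_lt_iff₀ (by positivity)] at hlt
  rw [← Real.sqrt_eq_rpow, ← div_lt_iff₀' hc₁]
  refine Real.lt_sqrt_of_sq_lt (lt_of_lt_of_le (b := (p : ℝ) ^ 3) ?_
    (by exact_mod_cast cube_le_maxOrder_prod))
  rw [div_pow, div_lt_iff₀ (by positivity)]
  calc (12 * (p : ℝ)) ^ 2 = 144 * p ^ 2 := by ring
    _ < p * c₁ ^ 2 * p ^ 2 := by gcongr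
    _ = p ^ 3 * c₁ ^ 2 := by ring
end

section
/- Let p ≥ 5 be a prime and let G be a finite p-group of exponent p³ such that the Hughes subgroup H_p(G) satisfies 1 ≠ H_p(G) ≠ G and |G : H_p(G)| ≥ p². Then o(G) < exp(G)^{1/2} = p^{3/2}. (Indeed, o(G) ≤ ((|G| − |G|/p²)·p + (|G|/p²)·p³)/|G| < 2p < p^{3/2}.) -/
/-- The Hughes subgroup `H_p(G) = ⟨x ∈ G ∣ x^p ≠ 1⟩`. -/
def hughesSubgroup (p : ℕ) (G : Type*) [Group G] : Subgroup G :=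
  Subgroup.closure {x : G | x ^ p ≠ 1}

theorem orderOf_le_of_notMem_hughesSubgroup {p : ℕ} (hp : 0 < p) {G : Type*} [Group G] {g : G}
    (hg : g ∉ hughesSubgroup p G) : orderOf g ≤ p := by
  refine orderOf_le_of_pow_eq_one hp ?_
  by_contra h
  exact hg (Subgroup.subset_closure h)

/-- If every element outside `H` has order at most `a`, then
`o(G) ≤ a + exp(G) / |G : H|`. -/
theorem avgOrder_le_add_exponent_div_index {G : Type*} [Group G] [Finite G] (H : Subgroup G)
    (a : ℕ) (h : ∀ g ∉ H, orderOf g ≤ a) :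
    avgOrder G ≤ a + (Monoid.exponent G : ℝ) / H.index := by
  classical
  have := Fintype.ofFinite G
  have hG : (0 : ℝ) < Nat.card G := by exact_mod_cast Nat.card_pos
  have hi : (0 : ℝ) < H.index := by exact_mod_cast Nat.pos_of_ne_zero H.index_ne_zero_of_finite
  have hmul : (Nat.card H : ℝ) * H.index = Nat.card G := by exact_mod_cast H.card_mul_index
  have hcard : (Finset.univ.filter (· ∈ H)).card = Nat.card H := by
    rw [Nat.card_eq_fintype_card, Fintype.card_subtype]
  have hsum : ∑ g : G, (orderOf g : ℝ) ≤
      Nat.card G * a + Nat.card H * Monoid.exponent G := by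
    calc ∑ g : G, (orderOf g : ℝ)
        ≤ ∑ g : G, ((a : ℝ) + if g ∈ H then (Monoid.exponent G : ℝ) else 0) := by
          refine Finset.sum_le_sum fun g _ => ?_
          split_ifs with hg
          · have : (orderOf g : ℝ) ≤ Monoid.exponent G := by
              exact_mod_cast Nat.le_of_dvd
                (Nat.pos_of_ne_zero Monoid.exponent_ne_zero_of_finite)
                (Monoid.order_dvd_exponent g)
            linarith [(Nat.cast_nonneg a : (0 : ℝ) ≤ a)]
          · simpa using h g hg
      _ = _ := by
          rw [Finset.sum_add_distrib, ← Finset.sum_filter, Finset.sum_const, Finset.sum_const,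
            hcard, Finset.card_univ, ← Nat.card_eq_fintype_card, nsmul_eq_mul, nsmul_eq_mul]
  rw [avgOrder, finsum_eq_sum_of_fintype, div_le_iff₀ hG]
  refine hsum.trans_eq ?_
  rw [← hmul]
  field_simp

/-- If `p ≥ 5` is a prime and `G` is a finite `p`-group of exponent `p^3` whose
Hughes subgroup satisfies `1 ≠ H_p(G) ≠ G` and `|G : H_p(G)| ≥ p²`, then
`o(G) < exp(G)^(1/2) = p^(3/2)`. -/
theorem avgOrder_lt_sqrt_exponent_of_antiHughes (p : ℕ) (hp : p.Prime) (hp5 : 5 ≤ p)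
    (G : Type*) [Group G] [Finite G] (hG : IsPGroup p G)
    (hexp : Monoid.exponent G = p ^ 3)
    (hne_bot : hughesSubgroup p G ≠ ⊥) (hne_top : hughesSubgroup p G ≠ ⊤)
    (hindex : p ^ 2 ≤ (hughesSubgroup p G).index) :
    avgOrder G < (Monoid.exponent G : ℝ) ^ ((1 : ℝ) / 2) ∧
      (Monoid.exponent G : ℝ) ^ ((1 : ℝ) / 2) = (p : ℝ) ^ ((3 : ℝ) / 2) := by
  have hp0 : (0 : ℝ) < p := by exact_mod_cast hp.pos
  have hp5' : (5 : ℝ) ≤ p := by exact_mod_cast hp5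
  have hindex' : (p : ℝ) ^ 2 ≤ (hughesSubgroup p G).index := by exact_mod_cast hindex
  have havg : avgOrder G ≤ 2 * p := by
    refine (avgOrder_le_add_exponent_div_index (hughesSubgroup p G) p
      fun g hg => orderOf_le_of_notMem_hughesSubgroup hp.pos hg).trans ?_
    have : (Monoid.exponent G : ℝ) / (hughesSubgroup p G).index ≤ p := by
      rw [div_le_iff₀ (lt_of_lt_of_le (by positivity) hindex'), hexp]
      push_cast
      nlinarith
    linarith
  rw [hexp, Nat.cast_pow]
  refine ⟨havg.trans_lt ?_, ?_⟩
  · rw [← Real.sqrt_eq_rpow]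
    refine Real.lt_sqrt_of_sq_lt ?_
    nlinarith [pow_pos hp0 2]
  · rw [← Real.rpow_natCast, ← Real.rpow_mul hp0.le]
    norm_num
end

section
/- For every prime p there exists a finite p-group P such that: (a) the Frattini subgroup Φ(P) has exponent p; (b) |P/Φ(P)| = p^p; and (c) every element of P \ Φ(P) has order p², and its p-th power is a nontrivial element of a central cyclic subgroup ⟨z⟩ of order p which equals the subgroup P^p generated by all p-th powers of elements of P. -/
/-- A maximal subgroup of a finite `p`-group is the kernel of a homomorphism to `ZMod p`. -/
theorem IsPGroup.exists_ker_eq_of_isCoatom {p : ℕ} [Fact p.Prime] {G : Type*} [Group G] [Finite G]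
    (hG : IsPGroup p G) {M : Subgroup G} (hM : IsCoatom M) :
    ∃ φ : G →* Multiplicative (ZMod p), φ.ker = M := by
  have := hG.isNilpotent
  have : M.Normal :=
    Subgroup.NormalizerCondition.normal_of_coatom M Group.normalizerCondition_of_isNilpotent hM
  have : Nontrivial (G ⧸ M) := QuotientGroup.nontrivial_iff.mpr hM.1
  obtain ⟨n, hn, hcard⟩ := (hG.to_quotient M).nontrivial_iff_card.mp this
  obtain ⟨x, hx⟩ := exists_prime_orderOf_dvd_card' (G := G ⧸ M) p
    (hcard ▸ dvd_pow_self p hn.ne')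
  have htop : Subgroup.zpowers x = ⊤ := by
    have hle : M ≤ (Subgroup.zpowers x).comap (QuotientGroup.mk' M) := by
      conv_lhs => rw [← QuotientGroup.ker_mk' M]
      exact MonoidHom.ker_le_comap _ _
    rcases hM.le_iff.mp hle with h | h
    · exact Subgroup.comap_injective (QuotientGroup.mk'_surjective M) (by rw [h, Subgroup.comap_top])
    · have hx1 : x = 1 := by
        obtain ⟨g, rfl⟩ := QuotientGroup.mk'_surjective M x
        have : g ∈ (Subgroup.zpowers (QuotientGroup.mk' M g)).comap (QuotientGroup.mk' M) := by simp
        rw [h] at this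
        simpa using this
      rw [hx1, orderOf_one] at hx
      exact absurd hx.symm (Fact.out : p.Prime).ne_one
  have hgen : ∀ y, y ∈ Subgroup.zpowers x := fun y => htop ▸ Subgroup.mem_top y
  have hcard' : Nat.card (G ⧸ M) = p := by rw [← orderOf_eq_card_of_forall_mem_zpowers hgen, hx]
  let e : Multiplicative (ZMod p) ≃* G ⧸ M := zmodMulEquivOfGenerator hgen hcard'
  refine ⟨e.symm.toMonoidHom.comp (QuotientGroup.mk' M), ?_⟩
  ext g
  simp

/-- Burnside's basis theorem in coordinates: if generators of a finite `p`-group are carried to a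
basis of a vector space over `ZMod p`, then the kernel is the Frattini subgroup. -/
theorem IsPGroup.frattini_eq_ker {p : ℕ} [Fact p.Prime] {G V ι : Type*} [Group G] [Finite G]
    (hG : IsPGroup p G) [AddCommGroup V] [Module (ZMod p) V] (b : Module.Basis ι (ZMod p) V)
    (f : G →* Multiplicative V) (g : ι → G) (hg : Subgroup.closure (Set.range g) = ⊤)
    (hf : ∀ i, f (g i) = Multiplicative.ofAdd (b i)) : frattini G = f.ker := by
  apply le_antisymm
  · intro x hx
    rw [MonoidHom.mem_ker]
    refine Multiplicative.toAdd.injective (b.ext_elem fun i => ?_)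
    let ψ : G →* Multiplicative (ZMod p) := (b.coord i).toAddMonoidHom.toMultiplicative.comp f
    have hψi : ψ (g i) = Multiplicative.ofAdd 1 := by simp [ψ, hf]
    have hψ : Function.Surjective ψ := by
      intro c
      refine ⟨g i ^ (Multiplicative.toAdd c).val, ?_⟩
      rw [map_pow, hψi, ← ofAdd_nsmul]
      simp
    have : Fact (Nat.card (Multiplicative (ZMod p))).Prime := ⟨by simpa using Fact.out⟩
    have : IsSimpleGroup (Multiplicative (ZMod p)) := isSimpleGroup_of_prime_card rfl
    have := frattini_le_coatom (Subgroup.isCoatom_comap_of_surjective hψ isCoatom_bot) hx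
    have h1 : ψ x = 1 := by simpa using this
    simpa [ψ] using congrArg Multiplicative.toAdd h1
  · refine le_iInf₂ fun M hM => ?_
    obtain ⟨φ, rfl⟩ := hG.exists_ker_eq_of_isCoatom hM
    let L : V →ₗ[ZMod p] ZMod p := b.constr ℕ fun i => Multiplicative.toAdd (φ (g i))
    have hL : L.toAddMonoidHom.toMultiplicative.comp f = φ := by
      refine MonoidHom.eq_of_eqOn_dense hg ?_
      rintro _ ⟨i, rfl⟩
      simp [hf, L, Module.Basis.constr_basis]
    intro x hx
    rw [MonoidHom.mem_ker] at hx ⊢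
    rw [← hL, MonoidHom.comp_apply, hx, map_one]

theorem MonoidHom.surjective_of_basis {p : ℕ} [NeZero p] {G V ι : Type*} [Group G]
    [AddCommGroup V] [Module (ZMod p) V] (b : Module.Basis ι (ZMod p) V)
    (f : G →* Multiplicative V) (g : ι → G) (hf : ∀ i, f (g i) = Multiplicative.ofAdd (b i)) :
    Function.Surjective f := by
  suffices ∀ v : V, ∃ x, f x = Multiplicative.ofAdd v from fun v => this (Multiplicative.toAdd v)
  intro v
  induction b.mem_span v using Submodule.span_induction with
  | mem v hv =>
    obtain ⟨i, rfl⟩ := hv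
    exact ⟨g i, hf i⟩
  | zero => exact ⟨1, map_one f⟩
  | add v w _ _ hv hw =>
    obtain ⟨x, hx⟩ := hv
    obtain ⟨y, hy⟩ := hw
    exact ⟨x * y, by rw [map_mul, hx, hy, ofAdd_add]⟩
  | smul t v _ hv =>
    obtain ⟨x, hx⟩ := hv
    exact ⟨x ^ t.val, by rw [map_pow, hx, ← ofAdd_nsmul, ← Nat.cast_smul_eq_nsmul (ZMod p),
      ZMod.natCast_zmod_val]⟩

/-- An upper unitriangular matrix whose superdiagonal is `a, a ^ p, a ^ p ^ 2, …`. -/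
structure IsFrobeniusUnitriangular {K : Type*} [Field K] (p n : ℕ) (a : K)
    (M : Matrix (Fin n) (Fin n) K) : Prop where
  lower : ∀ i j, j < i → M i j = 0
  diag : ∀ i, M i i = 1
  superdiag : ∀ i j : Fin n, j.val = i.val + 1 → M i j = a ^ p ^ i.val

/-- The `k`-th power of a strictly upper triangular matrix vanishes below the `k`-th superdiagonal,
where its entries are products of `k` consecutive superdiagonal entries. -/
theorem Matrix.pow_apply_of_strictUpper {K : Type*} [Field K] {n : ℕ}
    {A : Matrix (Fin n) (Fin n) K} (hA : ∀ i j, j ≤ i → A i j = 0) (c : ℕ → K)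
    (hc : ∀ i j : Fin n, j.val = i.val + 1 → A i j = c i.val) (k : ℕ) (i j : Fin n) :
    (j.val < i.val + k → (A ^ k) i j = 0) ∧
      (j.val = i.val + k → (A ^ k) i j = ∏ l ∈ Finset.range k, c (i.val + l)) := by
  induction k generalizing j with
  | zero =>
    refine ⟨fun h => ?_, fun h => ?_⟩
    · rw [pow_zero, Matrix.one_apply_ne (by rintro rfl; simp at h)]
    · obtain rfl : j = i := Fin.ext h
      simp
  | succ k ih =>
    rw [pow_succ, Matrix.mul_apply]
    refine ⟨fun h => Finset.sum_eq_zero fun m _ => ?_, fun h => ?_⟩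
    · rcases lt_or_ge m.val (i.val + k) with hm | hm
      · rw [(ih m).1 hm, zero_mul]
      · rw [hA m j (Fin.le_def.mpr (by omega)), mul_zero]
    · rw [Finset.sum_eq_single (⟨i.val + k, by omega⟩ : Fin n), (ih _).2 rfl,
        hc _ j (by simp only; omega), Finset.prod_range_succ]
      · intro m _ hm
        rcases lt_trichotomy m.val (i.val + k) with h' | h' | h'
        · rw [(ih m).1 h', zero_mul]
        · exact absurd (Fin.ext h') hm
        · rw [hA m j (Fin.le_def.mpr (by omega)), mul_zero]
      · simp

theorem Matrix.one_add_single_pow {K : Type*} [Field K] {n : Type*} [Fintype n] [DecidableEq n]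
    {i j : n} (h : i ≠ j) (c : K) (k : ℕ) :
    (1 + Matrix.single i j c) ^ k = 1 + Matrix.single i j (k * c) := by
  induction k with
  | zero => simp
  | succ k ih =>
    rw [pow_succ, ih, mul_add, mul_one, add_mul, one_mul,
      Matrix.single_mul_single_of_ne _ _ _ _ h.symm, add_zero, add_assoc, ← Matrix.single_add]
    push_cast
    ring_nf

@[simp]
theorem Matrix.single_eq_zero {m n α : Type*} [DecidableEq m] [DecidableEq n] [Zero α] {i : m}
    {j : n} {c : α} : Matrix.single i j c = 0 ↔ c = 0 :=
  ⟨fun h => by simpa using congrFun (congrFun h i) j, fun h => by rw [h, Matrix.single_zero]⟩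

namespace IsFrobeniusUnitriangular

variable {K : Type*} [Field K] {p n : ℕ} {a b : K} {M N : Matrix (Fin n) (Fin n) K}

theorem one (hp : p.Prime) : IsFrobeniusUnitriangular p n (0 : K) 1 where
  lower i j h := Matrix.one_apply_ne h.ne'
  diag i := Matrix.one_apply_eq i
  superdiag i j h := by
    rw [Matrix.one_apply_ne (by rintro rfl; omega), zero_pow (pow_ne_zero _ hp.ne_zero)]

theorem mul [Fact p.Prime] [CharP K p] (hM : IsFrobeniusUnitriangular p n a M)
    (hN : IsFrobeniusUnitriangular p n b N) : IsFrobeniusUnitriangular p n (a + b) (M * N) where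
  lower i j h := by
    rw [Matrix.mul_apply]
    refine Finset.sum_eq_zero fun k _ => ?_
    rcases lt_or_ge k i with hk | hk
    · rw [hM.lower i k hk, zero_mul]
    · rw [hN.lower k j (h.trans_le hk), mul_zero]
  diag i := by
    rw [Matrix.mul_apply, Finset.sum_eq_single i, hM.diag, hN.diag, one_mul]
    · intro k _ hk
      rcases lt_or_gt_of_ne hk with hk | hk
      · rw [hM.lower i k hk, zero_mul]
      · rw [hN.lower k i hk, mul_zero]
    · simp
  superdiag i j h := by
    have hij : i ≠ j := by rintro rfl; omega
    rw [Matrix.mul_apply, Finset.sum_eq_add i j hij, hM.diag, hN.diag,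
      hM.superdiag i j h, hN.superdiag i j h, add_pow_char_pow, one_mul, mul_one, add_comm]
    · rintro k - ⟨hki, hkj⟩
      rcases lt_or_gt_of_ne hki with hk | hk
      · rw [hM.lower i k hk, zero_mul]
      · rw [hN.lower k j (Fin.lt_def.mpr (by have := Fin.val_ne_of_ne hkj; omega)), mul_zero]
    · simp
    · simp

theorem exists_matrix (p n : ℕ) (a : K) :
    ∃ M : Matrix (Fin n) (Fin n) K, IsFrobeniusUnitriangular p n a M := by
  refine ⟨fun i j => if j = i then 1 else if j.val = i.val + 1 then a ^ p ^ i.val else 0,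
    ⟨fun i j h => ?_, fun i => if_pos rfl, fun i j h => ?_⟩⟩
  · rw [if_neg h.ne, if_neg (by omega)]
  · rw [if_neg (by rintro rfl; omega), if_pos h]

/-- The corner entry of the `p`-th power is the norm form of `a`. -/
theorem pow_char [Fact p.Prime] [CharP K p] {M : Matrix (Fin (p + 1)) (Fin (p + 1)) K}
    (hM : IsFrobeniusUnitriangular p (p + 1) a M) :
    M ^ p = 1 + Matrix.single 0 (Fin.last p) (∏ l ∈ Finset.range p, a ^ p ^ l) := by
  have hA : ∀ i j, j ≤ i → (M - 1) i j = 0 := by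
    intro i j h
    rcases h.lt_or_eq with h | rfl
    · rw [Matrix.sub_apply, hM.lower i j h, Matrix.one_apply_ne h.ne', sub_zero]
    · rw [Matrix.sub_apply, hM.diag, Matrix.one_apply_eq, sub_self]
  have hc : ∀ i j : Fin (p + 1), j.val = i.val + 1 → (M - 1) i j = a ^ p ^ i.val := by
    intro i j h
    rw [Matrix.sub_apply, hM.superdiag i j h, Matrix.one_apply_ne (by rintro rfl; omega), sub_zero]
  have hpow := Matrix.pow_apply_of_strictUpper hA (fun l => a ^ p ^ l) hc p
  have hM1 : M = 1 + (M - 1) := by abel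
  conv_lhs => rw [hM1, add_pow_char_of_commute p (Commute.one_left _), one_pow]
  congr 1
  ext i j
  by_cases hij : i = 0 ∧ j = Fin.last p
  · obtain ⟨rfl, rfl⟩ := hij
    rw [(hpow _ _).2 (by simp), Matrix.single_apply_same]
    simp
  · rw [(hpow i j).1, Matrix.single_apply_of_ne]
    · tauto
    · by_contra! h
      exact hij ⟨Fin.ext (by rw [Fin.val_zero]; omega), Fin.ext (by rw [Fin.val_last]; omega)⟩

theorem pow_char_sq [Fact p.Prime] [CharP K p] {M : Matrix (Fin (p + 1)) (Fin (p + 1)) K}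
    (hM : IsFrobeniusUnitriangular p (p + 1) a M) : M ^ p ^ 2 = 1 := by
  have h : (0 : Fin (p + 1)) ≠ Fin.last p := Fin.ext_iff.not.mpr (NeZero.ne p).symm
  rw [sq, pow_mul, hM.pow_char, Matrix.one_add_single_pow h]
  simp

theorem unique (hn : 2 ≤ n) (ha : IsFrobeniusUnitriangular p n a M)
    (hb : IsFrobeniusUnitriangular p n b M) : a = b := by
  simpa using (ha.superdiag ⟨0, by omega⟩ ⟨1, hn⟩ rfl).symm.trans
    (hb.superdiag ⟨0, by omega⟩ ⟨1, hn⟩ rfl)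

theorem mul_single_last {M : Matrix (Fin (n + 1)) (Fin (n + 1)) K}
    (hM : IsFrobeniusUnitriangular p (n + 1) a M) (c : K) :
    M * Matrix.single 0 (Fin.last n) c = Matrix.single 0 (Fin.last n) c := by
  ext i j
  by_cases hj : j = Fin.last n
  · subst hj
    rw [Matrix.mul_single_apply_same]
    rcases eq_or_ne i 0 with rfl | hi
    · rw [hM.diag, one_mul, Matrix.single_apply_same]
    · rw [hM.lower i 0 (Fin.pos_of_ne_zero hi), zero_mul, Matrix.single_apply_of_ne]
      exact fun h => hi h.1.symm
  · rw [Matrix.mul_single_apply_of_ne _ _ _ _ _ hj, Matrix.single_apply_of_ne]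
    exact fun h => hj h.2.symm

theorem single_last_mul {M : Matrix (Fin (n + 1)) (Fin (n + 1)) K}
    (hM : IsFrobeniusUnitriangular p (n + 1) a M) (c : K) :
    Matrix.single (0 : Fin (n + 1)) (Fin.last n) c * M = Matrix.single 0 (Fin.last n) c := by
  ext i j
  by_cases hi : i = 0
  · subst hi
    rw [Matrix.single_mul_apply_same]
    rcases eq_or_ne j (Fin.last n) with rfl | hj
    · rw [hM.diag, mul_one, Matrix.single_apply_same]
    · rw [hM.lower _ j (Fin.lt_last_iff_ne_last.mpr hj), mul_zero, Matrix.single_apply_of_ne]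
      exact fun h => hj h.2.symm
  · rw [Matrix.single_mul_apply_of_ne _ _ _ _ _ hi, Matrix.single_apply_of_ne]
    exact fun h => hi h.1.symm

end IsFrobeniusUnitriangular

theorem FiniteField.exists_natCast_prod_pow_eq {p n : ℕ} [Fact p.Prime] (hn : n ≠ 0)
    (a : GaloisField p n) : ∃ k : ℕ, ∏ l ∈ Finset.range n, a ^ p ^ l = k := by
  have := FiniteField.algebraMap_norm_eq_prod_pow (ZMod p) (GaloisField p n) a
  rw [GaloisField.finrank p hn, Nat.card_zmod] at this
  refine ⟨(Algebra.norm (ZMod p) a).val, ?_⟩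
  rw [← this, ← map_natCast (algebraMap (ZMod p) (GaloisField p n)), ZMod.natCast_zmod_val]

/-- Wall's secretive `p`-groups: for every prime `p` there exists a finite
`p`-group `P` such that
(a) the Frattini subgroup `Φ(P)` has exponent `p`;
(b) `|P/Φ(P)| = p^p`; and
(c) every element of `P \ Φ(P)` has order `p²`, with its `p`-th power a
nontrivial element of a central cyclic subgroup `⟨z⟩` of order `p` which equals
the subgroup `P^p` generated by all `p`-th powers. -/
theorem exists_secretive_pGroup (p : ℕ) (hp : p.Prime) :
    ∃ (P : Type) (_ : Group P) (_ : Finite P), IsPGroup p P ∧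
      Monoid.exponent (frattini P) = p ∧
      Nat.card (P ⧸ frattini P) = p ^ p ∧
      ∃ z : P, z ∈ Subgroup.center P ∧ orderOf z = p ∧
        Subgroup.zpowers z = Subgroup.closure {g : P | ∃ x : P, x ^ p = g} ∧
        ∀ x : P, x ∉ frattini P →
          orderOf x = p ^ 2 ∧ x ^ p ≠ 1 ∧ x ^ p ∈ Subgroup.zpowers z := by
  have : Fact p.Prime := ⟨hp⟩
  let K := GaloisField p p
  have : CharP K p := charP_of_injective_algebraMap (algebraMap (ZMod p) K).injective p
  let b : Module.Basis _ (ZMod p) K := Module.finBasis (ZMod p) K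
  have hunit (a : K) : ∃ u : (Matrix (Fin (p + 1)) (Fin (p + 1)) K)ˣ,
      IsFrobeniusUnitriangular p (p + 1) a u.val := by
    obtain ⟨M, hM⟩ := IsFrobeniusUnitriangular.exists_matrix p (p + 1) a
    exact ⟨Units.ofPowEqOne M (p ^ 2) hM.pow_char_sq (pow_ne_zero _ hp.ne_zero), hM⟩
  choose u hu using hunit
  have : Finite (Matrix (Fin (p + 1)) (Fin (p + 1)) K) := inferInstanceAs (Finite (_ → _ → K))
  let P := Subgroup.closure (Set.range fun i => u (b i))
  have hP (x) (hx : x ∈ P) : ∃ a : K, IsFrobeniusUnitriangular p (p + 1) a x.val := by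
    rw [← Subgroup.mem_toSubmonoid, Subgroup.closure_toSubmonoid_of_finite] at hx
    induction hx using Submonoid.closure_induction with
    | mem x hx =>
      obtain ⟨i, rfl⟩ := hx
      exact ⟨_, hu _⟩
    | one => exact ⟨0, .one hp⟩
    | mul x y _ _ hx hy =>
      obtain ⟨a, ha⟩ := hx
      obtain ⟨c, hc⟩ := hy
      exact ⟨a + c, ha.mul hc⟩
  have hP' (x : P) := hP x x.2
  choose f₀ hf₀ using hP'
  let f : P →* Multiplicative K := MonoidHom.mk' (fun x => Multiplicative.ofAdd (f₀ x))
    fun x y => congrArg Multiplicative.ofAdd <|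
      (hf₀ (x * y)).unique (Nat.succ_le_succ hp.pos) ((hf₀ x).mul (hf₀ y))
  have hpow (x : P) : ((x ^ p : P).val.val : Matrix (Fin (p + 1)) (Fin (p + 1)) K) =
      1 + Matrix.single 0 (Fin.last p) (∏ l ∈ Finset.range p, f₀ x ^ p ^ l) := (hf₀ x).pow_char
  have hpow_sq (x : P) : x ^ p ^ 2 = 1 := Subtype.ext (Units.ext (hf₀ x).pow_char_sq)
  have hpow_eq_one (x : P) : x ^ p = 1 ↔ f₀ x = 0 := by
    rw [Subtype.ext_iff, Units.ext_iff, hpow]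
    change 1 + _ = 1 ↔ _
    rw [add_eq_left, Matrix.single_eq_zero, Finset.prod_eq_zero_iff]
    exact ⟨fun ⟨l, _, hl⟩ => eq_zero_of_pow_eq_zero hl,
      fun h => ⟨0, by simpa using hp.pos, by simpa using h⟩⟩
  have hPG : IsPGroup p P := fun x => ⟨2, hpow_sq x⟩
  let g (i) : P := ⟨u (b i), Subgroup.subset_closure ⟨i, rfl⟩⟩
  have hg : Subgroup.closure (Set.range g) = ⊤ := by
    rw [← Subgroup.closure_closure_coe_preimage]
    congr 1
    ext x
    simp [g, Subtype.ext_iff]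
  have hfg (i) : f (g i) = Multiplicative.ofAdd (b i) :=
    congrArg Multiplicative.ofAdd ((hf₀ (g i)).unique (Nat.succ_le_succ hp.pos) (hu (b i)))
  have hfrat : frattini P = f.ker := hPG.frattini_eq_ker b f g hg hfg
  have hmem (x : P) : x ∈ frattini P ↔ x ^ p = 1 := by
    rw [hfrat, MonoidHom.mem_ker, hpow_eq_one]
    rfl
  have hsurj : Function.Surjective f := f.surjective_of_basis b g hfg
  obtain ⟨x₀, hx₀⟩ := hsurj (Multiplicative.ofAdd 1)
  replace hx₀ : f₀ x₀ = 1 := hx₀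
  have hz : ((x₀ ^ p : P).val.val : Matrix (Fin (p + 1)) (Fin (p + 1)) K) =
      1 + Matrix.single 0 (Fin.last p) 1 := by
    rw [hpow, hx₀]
    simp
  have hz1 : x₀ ^ p ≠ 1 := by simp [hpow_eq_one, hx₀]
  have hzp : (x₀ ^ p) ^ p = 1 := by rw [← pow_mul, ← sq, hpow_sq]
  have hmem_zpowers (x : P) : x ^ p ∈ Subgroup.zpowers (x₀ ^ p) := by
    obtain ⟨k, hk⟩ := FiniteField.exists_natCast_prod_pow_eq hp.ne_zero (f₀ x)
    refine ⟨k, ?_⟩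
    simp only [zpow_natCast]
    refine Subtype.ext (Units.ext ?_)
    rw [hpow, hk]
    change ((x₀ ^ p : P).val.val : Matrix (Fin (p + 1)) (Fin (p + 1)) K) ^ k = _
    rw [hz, Matrix.one_add_single_pow (Fin.ext_iff.not.mpr hp.ne_zero.symm), mul_one]
  refine ⟨P, inferInstance, inferInstance, hPG, ?_, ?_, x₀ ^ p, ?_, orderOf_eq_prime hzp hz1, ?_,
    fun x hx => ⟨?_, (hmem x).not.mp hx, hmem_zpowers x⟩⟩
  · refine ((Nat.dvd_prime hp).mp (Monoid.exponent_dvd_of_forall_pow_eq_one fun x =>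
      Subtype.ext ((hmem x.1).mp x.2))).resolve_left fun h => hz1 ?_
    have := Monoid.pow_exponent_eq_one (⟨x₀ ^ p, (hmem _).mpr hzp⟩ : frattini P)
    rw [h, pow_one] at this
    exact congrArg Subtype.val this
  · rw [hfrat, Nat.card_congr (QuotientGroup.quotientKerEquivOfSurjective f hsurj).toEquiv]
    exact GaloisField.card p p hp.ne_zero
  · rw [Subgroup.mem_center_iff]
    intro y
    refine Subtype.ext (Units.ext ?_)
    change y.val.val * (x₀ ^ p : P).val.val = (x₀ ^ p : P).val.val * y.val.val
    rw [hz, mul_add, add_mul, mul_one, one_mul, (hf₀ y).mul_single_last,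
      (hf₀ y).single_last_mul]
  · refine le_antisymm ?_ ?_
    · rw [Subgroup.zpowers_le]
      exact Subgroup.subset_closure ⟨x₀, rfl⟩
    · rw [Subgroup.closure_le]
      rintro _ ⟨x, rfl⟩
      exact hmem_zpowers x
  · exact orderOf_eq_prime_pow (by simpa using (hmem x).not.mp hx) (hpow_sq x)
end

section
/- Let p be a prime and let P be a finite p-group such that Φ(P) has exponent p, |P/Φ(P)| = p^p, and every element of P \ Φ(P) has order p² with its p-th power a nontrivial element of a central cyclic subgroup ⟨z⟩ = P^p of order p. Then for every integer s > 0 there exist a finite homocyclic abelian group U_s of exponent p^s (i.e., a direct product of copies of the cyclic group of order p^s) and an action of P on U_s by automorphisms such that in the semidirect product U_s ⋊ P: (a) every element of (U_s ⋊ P) \ (U_s ⋊ Φ(P)) has order p²; and (b) every element of U_s ⋊ Φ(P) has order at most p^{s+1}. -/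
namespace SemidirectProduct

variable {N G : Type*} [Group G]

theorem pow_right [Group N] {φ : G →* MulAut N} (g : N ⋊[φ] G) (n : ℕ) :
    (g ^ n).right = g.right ^ n :=
  map_pow (rightHom : N ⋊[φ] G →* G) g n

theorem pow_left [CommGroup N] {φ : G →* MulAut N} (g : N ⋊[φ] G) (n : ℕ) :
    (g ^ n).left = ∏ i ∈ Finset.range n, φ (g.right ^ i) g.left := by
  induction n with
  | zero => simp
  | succ n ih => rw [pow_succ, mul_left, ih, pow_right, Finset.prod_range_succ]

end SemidirectProduct

/-- The linear map on functions `G → R` summing over the left cosets of `Z`. -/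
noncomputable def cosetSum (R : Type*) [CommRing R] {G : Type*} [Group G] (Z : Subgroup G)
    [Fintype Z] : (G → R) →ₗ[R] (G → R) where
  toFun f x := ∑ h : Z, f (x * h)
  map_add' f g := by ext x; simp [Finset.sum_add_distrib]
  map_smul' c f := by ext x; simp [Finset.mul_sum]

section CosetSum

variable {R : Type*} [CommRing R] {G : Type*} [Group G] (Z : Subgroup G) [Fintype Z]

theorem cosetSum_apply (f : G → R) (x : G) : cosetSum R Z f x = ∑ h : Z, f (x * h) := rfl

theorem cosetSum_mul_right (f : G → R) (x : G) (k : Z) :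
    cosetSum R Z f (x * k) = cosetSum R Z f x := by
  simp only [cosetSum_apply, mul_assoc]
  exact Fintype.sum_equiv (Equiv.mulLeft k) _ _ fun h => by simp

open Classical in
/-- The projection onto the kernel of `cosetSum` that subtracts the sum over each coset from the
value at the chosen representative of that coset. -/
noncomputable def cosetSumKerProj (f : G → R) (x : G) : R :=
  f x - if (QuotientGroup.mk x : G ⧸ Z).out = x then cosetSum R Z f x else 0

theorem cosetSumKerProj_mem (f : G → R) : cosetSumKerProj Z f ∈ LinearMap.ker (cosetSum R Z) := by
  classical
  rw [LinearMap.mem_ker]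
  ext x
  obtain ⟨k, hk⟩ := QuotientGroup.mk_out_eq_mul Z x
  have hmk (h : Z) : (QuotientGroup.mk (x * (h : G)) : G ⧸ Z) = QuotientGroup.mk x := by simp
  have hiff (h : Z) : x * (k : G) = x * h ↔ k = h := by simp
  simp only [cosetSum_apply Z (cosetSumKerProj Z f), cosetSumKerProj, Finset.sum_sub_distrib,
    cosetSum_mul_right, hmk, hk, hiff, Finset.sum_ite_eq, Finset.mem_univ, if_true,
    ← cosetSum_apply Z f, sub_self, Pi.zero_apply]

/-- `cosetSumKerProj` as a linear map onto the kernel of `cosetSum`. -/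
noncomputable def toCosetSumKer : (G → R) →ₗ[R] LinearMap.ker (cosetSum R Z) :=
  LinearMap.codRestrict _
    { toFun := cosetSumKerProj Z
      map_add' := fun f g => by
        ext x; simp only [cosetSumKerProj, map_add, Pi.add_apply]; split_ifs <;> ring
      map_smul' := fun c f => by
        ext x
        simp only [cosetSumKerProj, map_smul, Pi.smul_apply, smul_eq_mul, RingHom.id_apply]
        split_ifs <;> ring }
    (cosetSumKerProj_mem Z)

theorem toCosetSumKer_comp_subtype :
    toCosetSumKer Z ∘ₗ (LinearMap.ker (cosetSum R Z)).subtype = LinearMap.id := by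
  ext f x
  have hf : cosetSum R Z f.1 = 0 := f.2
  change cosetSumKerProj Z f.1 x = f.1 x
  simp [cosetSumKerProj, hf]

instance [Finite G] : Module.Projective R (LinearMap.ker (cosetSum R Z)) :=
  Module.Projective.of_split _ _ (toCosetSumKer_comp_subtype Z)

instance [Finite G] : Module.Finite R (LinearMap.ker (cosetSum R Z)) :=
  Module.Finite.of_surjective (toCosetSumKer Z) fun f =>
    ⟨f.1, LinearMap.congr_fun (toCosetSumKer_comp_subtype Z) f⟩

instance [Nontrivial R] [Nontrivial Z] : Nontrivial (LinearMap.ker (cosetSum R Z)) := by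
  classical
  obtain ⟨k, hk⟩ := exists_ne (1 : Z)
  set t : G := (QuotientGroup.mk 1 : G ⧸ Z).out with ht
  have hmk : (QuotientGroup.mk (t * (k : G)) : G ⧸ Z) = QuotientGroup.mk 1 := by
    rw [QuotientGroup.mk_mul_of_mem _ k.2, ht, QuotientGroup.out_eq']
  have hne : (QuotientGroup.mk (t * (k : G)) : G ⧸ Z).out ≠ t * k := by
    rw [hmk, ← ht]
    simpa using hk
  refine ⟨⟨_, cosetSumKerProj_mem Z (Pi.single (t * (k : G)) 1)⟩, 0, fun h => ?_⟩
  have := congr_fun (congr_arg Subtype.val h) (t * (k : G))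
  change cosetSumKerProj Z _ _ = 0 at this
  rw [cosetSumKerProj, if_neg hne, sub_zero, Pi.single_eq_same] at this
  exact one_ne_zero this

/-- Right translation on the functions whose sum over each coset of a central subgroup vanishes. -/
noncomputable def cosetSumKerRep (hZ : Z ≤ Subgroup.center G) :
    Representation R G (LinearMap.ker (cosetSum R Z)) where
  toFun g := (LinearMap.funLeft R R (· * g)).restrict fun f hf => by
    rw [LinearMap.mem_ker] at hf ⊢
    ext x
    refine Eq.trans ?_ (congr_fun hf (x * g))
    simp only [cosetSum_apply, LinearMap.funLeft_apply]
    exact Finset.sum_congr rfl fun h _ => by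
      rw [mul_assoc, mul_assoc, Subgroup.mem_center_iff.mp (hZ h.2) g]
  map_one' := by ext f x; simp [LinearMap.funLeft_apply]
  map_mul' g h := by ext f x; simp [LinearMap.funLeft_apply, mul_assoc]

theorem cosetSumKerRep_apply (hZ : Z ≤ Subgroup.center G) (g : G)
    (f : LinearMap.ker (cosetSum R Z)) (x : G) : (cosetSumKerRep Z hZ g f).1 x = f.1 (x * g) := rfl

theorem sum_cosetSumKerRep (hZ : Z ≤ Subgroup.center G) :
    ∑ h : Z, cosetSumKerRep (R := R) Z hZ h = 0 := by
  ext f x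
  have hf : cosetSum R Z f.1 = 0 := f.2
  simpa [cosetSumKerRep_apply, cosetSum_apply] using congr_fun hf x

end CosetSum

/-- A central subgroup `Z ≠ 1` of a finite group `G` acts on some free module of positive rank over
a given local ring in such a way that the norm element of `Z` acts as zero, and this action extends
to `G`. -/
theorem exists_representation_sum_eq_zero (R : Type*) [CommRing R] [IsLocalRing R] {G : Type*}
    [Group G] [Finite G] (Z : Subgroup G) [Fintype Z] [Nontrivial Z]
    (hZ : Z ≤ Subgroup.center G) :
    ∃ r : ℕ, 0 < r ∧ ∃ ρ : Representation R G (Fin r → R), ∑ h : Z, ρ h = 0 := by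
  have : Module.Free R (LinearMap.ker (cosetSum R Z)) := Module.free_of_flat_of_isLocalRing
  let e := (Module.finBasis R (LinearMap.ker (cosetSum R Z))).equivFun
  refine ⟨_, (Module.finrank_pos_iff_of_free R _).mpr inferInstance,
    e.conjRingEquiv.toMonoidHom.comp (cosetSumKerRep Z hZ), ?_⟩
  have := congr_arg e.conjRingEquiv (sum_cosetSumKerRep (R := R) Z hZ)
  rwa [map_sum, map_zero] at this

theorem ZMod.isLocalRing_prime_pow (p : ℕ) [Fact p.Prime] {s : ℕ} (hs : s ≠ 0) :
    IsLocalRing (ZMod (p ^ s)) :=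
  have : Fact (1 < p ^ s) := ⟨Nat.one_lt_pow hs (Fact.out : p.Prime).one_lt⟩
  IsLocalRing.of_surjective' (PadicInt.toZModPow (p := p) s) (ZMod.ringHom_surjective _)

theorem sum_range_orderOf_pow {G M : Type*} [Group G] [Finite G] [AddCommMonoid M] (y : G)
    [Fintype (Subgroup.zpowers y)] (F : G → M) :
    ∑ i ∈ Finset.range (orderOf y), F (y ^ i) = ∑ h : Subgroup.zpowers y, F h := by
  rw [Finset.sum_range]
  exact Fintype.sum_equiv (finEquivZPowers (isOfFinOrder_of_finite y)) _ _ fun _ => rfl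


/-- Let `P` be a finite `p`-group such that `Φ(P)` has exponent `p`,
`|P/Φ(P)| = p^p`, and every element of `P \ Φ(P)` has order `p²` with its `p`-th
power a nontrivial element of a central cyclic subgroup `⟨z⟩ = P^p` of order `p`.
Then for every integer `s > 0` there are a finite homocyclic abelian group `U`
of exponent `p^s` (a direct product of at least one copy of `ℤ/p^sℤ`) and an
action `φ` of `P` on `U` by automorphisms such that in `U ⋊[φ] P`:
(a) every element outside the preimage of `Φ(P)` has order `p²`; and
(b) every element of the preimage of `Φ(P)` has order at most `p^(s+1)`. -/
theorem secretive_pGroup_semidirect_counterexample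
    (p : ℕ) (hp : p.Prime) (P : Type*) [Group P] [Finite P] (hP : IsPGroup p P)
    (hΦexp : Monoid.exponent (frattini P) = p)
    (hcard : Nat.card (P ⧸ frattini P) = p ^ p)
    (z : P) (hz : z ∈ Subgroup.center P) (hzord : orderOf z = p)
    (hzpow : Subgroup.zpowers z = Subgroup.closure {g : P | ∃ x : P, x ^ p = g})
    (hout : ∀ x : P, x ∉ frattini P →
      orderOf x = p ^ 2 ∧ x ^ p ≠ 1 ∧ x ^ p ∈ Subgroup.zpowers z)
    (s : ℕ) (hs : 0 < s) :
    ∃ (U : Type) (_ : CommGroup U) (_ : Finite U) (r : ℕ),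
      0 < r ∧ Nonempty (U ≃* Multiplicative (Fin r → ZMod (p ^ s))) ∧
      ∃ φ : P →* MulAut U,
        (∀ g : U ⋊[φ] P, g.right ∉ frattini P → orderOf g = p ^ 2) ∧
        (∀ g : U ⋊[φ] P, g.right ∈ frattini P → orderOf g ≤ p ^ (s + 1)) := by
  classical
  have : Fact p.Prime := ⟨hp⟩
  have : IsLocalRing (ZMod (p ^ s)) := ZMod.isLocalRing_prime_pow p hs.ne'
  have : NeZero (p ^ s) := ⟨pow_ne_zero s hp.ne_zero⟩
  have := Fintype.ofFinite (Subgroup.zpowers z)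
  have hZcard : Nat.card (Subgroup.zpowers z) = p := by rw [Nat.card_zpowers, hzord]
  have : Nontrivial (Subgroup.zpowers z) :=
    Finite.one_lt_card_iff_nontrivial.mp (hZcard ▸ hp.one_lt)
  obtain ⟨r, hr, ρ, hρ⟩ := exists_representation_sum_eq_zero (ZMod (p ^ s))
    (Subgroup.zpowers z) (Subgroup.zpowers_le.mpr hz)
  let _ : DistribMulAction P (Fin r → ZMod (p ^ s)) := DistribMulAction.compHom _ ρ
  let φ : P →* MulAut (Multiplicative (Fin r → ZMod (p ^ s))) :=
    (MulAutMultiplicative (Fin r → ZMod (p ^ s))).symm.toMonoidHom.comp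
      (DistribMulAction.toAddAut P (Fin r → ZMod (p ^ s)))
  have hφ (g : P) (u : Multiplicative (Fin r → ZMod (p ^ s))) :
      φ g u = Multiplicative.ofAdd (ρ g u.toAdd) := rfl
  refine ⟨Multiplicative (Fin r → ZMod (p ^ s)), inferInstance, inferInstance, r, hr,
    ⟨MulEquiv.refl _⟩, φ, fun g hg => ?_, fun g hg => ?_⟩
  · obtain ⟨hord, hne, hmem⟩ := hout g.right hg
    refine orderOf_eq_prime_pow (n := 1) (fun h => hne ?_) ?_
    · simpa [SemidirectProduct.pow_right] using congr_arg SemidirectProduct.right h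
    have hgen : Subgroup.zpowers (g.right ^ p) = Subgroup.zpowers z := by
      refine Subgroup.eq_of_le_of_card_ge (Subgroup.zpowers_le.mpr hmem) ?_
      rw [hZcard, Nat.card_zpowers, orderOf_eq_prime
        (by rw [← pow_mul, ← sq, ← hord, pow_orderOf_eq_one]) hne]
    have hordp : orderOf (g.right ^ p) = p := by rw [← Nat.card_zpowers, hgen, hZcard]
    have hsum : ∑ i ∈ Finset.range p, ρ ((g.right ^ p) ^ i) = 0 := by
      have := Fintype.ofFinite (Subgroup.zpowers (g.right ^ p))
      have h := sum_range_orderOf_pow (g.right ^ p) ρ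
      rw [hordp] at h
      rw [h, ← hρ]
      exact Fintype.sum_equiv (Equiv.setCongr (congr_arg _ hgen)) _ _ fun _ => rfl
    rw [one_add_one_eq_two, sq, pow_mul]
    ext1
    · rw [SemidirectProduct.pow_left, SemidirectProduct.pow_right]
      simp only [hφ, ← ofAdd_sum, ← LinearMap.sum_apply, hsum]
      rfl
    · rw [SemidirectProduct.pow_right, SemidirectProduct.pow_right, ← pow_mul, ← sq, ← hord,
        pow_orderOf_eq_one, SemidirectProduct.one_right]
  · refine Nat.le_of_dvd (pow_pos hp.pos _) (orderOf_dvd_of_pow_eq_one ?_)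
    have hright : (g ^ p).right = 1 := by
      have h := Monoid.pow_exponent_eq_one (⟨g.right, hg⟩ : frattini P)
      rw [hΦexp] at h
      rw [SemidirectProduct.pow_right]
      exact congr_arg Subtype.val h
    rw [pow_succ', pow_mul]
    ext1
    · rw [SemidirectProduct.pow_left, hright]
      simp only [one_pow, map_one, MulAut.one_apply, Finset.prod_const, Finset.card_range]
      ext i
      simp
    · rw [SemidirectProduct.pow_right, hright, one_pow, SemidirectProduct.one_right]
end

section
/- Let p be a prime and let G be a finite group with a subgroup H such that |G : H| ≥ p^p, every element of G \ H has order at most p², and every element of H has order at most p^{p+2}. Then o(G) ≤ p² − p^{2−p} + p² < 2p². -/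
/-- If the elements of a subgroup `H` have order at most `B` and the other elements of `G` have
order at most `A`, then `o(G) ≤ A + (B - A) / |G : H|`. -/
theorem avgOrder_le_add_div_index {G : Type*} [Group G] [Finite G] (H : Subgroup G) {A B : ℝ}
    (hout : ∀ g : G, g ∉ H → (orderOf g : ℝ) ≤ A) (hin : ∀ g : G, g ∈ H → (orderOf g : ℝ) ≤ B) :
    avgOrder G ≤ A + (B - A) / H.index := by
  classical
  have := Fintype.ofFinite G
  have hsum : ∑ g : G, (orderOf g : ℝ) ≤ Nat.card G * A + Nat.card H * (B - A) :=
    calc ∑ g : G, (orderOf g : ℝ) ≤ ∑ g : G, (A + if g ∈ H then B - A else 0) := by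
          refine Finset.sum_le_sum fun g _ => ?_
          split_ifs with hg
          · linarith [hin g hg]
          · linarith [hout g hg]
      _ = Nat.card G * A + Nat.card H * (B - A) := by
          rw [Finset.sum_add_distrib, ← Finset.sum_filter]
          simp [Nat.card_eq_fintype_card, Fintype.card_subtype]
          ring
  have hG : (Nat.card G : ℝ) = Nat.card H * H.index := by exact_mod_cast H.card_mul_index.symm
  have hH : (0 : ℝ) < Nat.card H := by exact_mod_cast Nat.card_pos
  have hk : (0 : ℝ) < H.index := by exact_mod_cast Nat.pos_of_ne_zero H.index_ne_zero_of_finite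
  rw [avgOrder, finsum_eq_sum_of_fintype, div_le_iff₀ (hG ▸ mul_pos hH hk)]
  refine hsum.trans_eq ?_
  rw [hG]
  field_simp

/-- Let `p` be a prime and `G` a finite group with a subgroup `H` of index at
least `p^p` such that every element of `G \ H` has order at most `p²` and every
element of `H` has order at most `p^(p+2)`. Then
`o(G) ≤ p² - p^(2-p) + p² < 2p²`. -/
theorem avgOrder_le_of_small_orders (p : ℕ) (hp : p.Prime)
    (G : Type*) [Group G] [Finite G] (H : Subgroup G)
    (hindex : p ^ p ≤ H.index)
    (hout : ∀ g : G, g ∉ H → orderOf g ≤ p ^ 2)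
    (hin : ∀ h : G, h ∈ H → orderOf h ≤ p ^ (p + 2)) :
    avgOrder G ≤ (p : ℝ) ^ 2 - (p : ℝ) ^ ((2 : ℤ) - (p : ℤ)) + (p : ℝ) ^ 2 ∧
      (p : ℝ) ^ 2 - (p : ℝ) ^ ((2 : ℤ) - (p : ℤ)) + (p : ℝ) ^ 2 < 2 * (p : ℝ) ^ 2 := by
  have hp0 : (0 : ℝ) < p := by exact_mod_cast hp.pos
  have hp1 : (1 : ℝ) ≤ p := by exact_mod_cast hp.one_le
  refine ⟨?_, by linarith [zpow_pos hp0 ((2 : ℤ) - (p : ℤ))]⟩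
  have hle : (p : ℝ) ^ 2 ≤ (p : ℝ) ^ (p + 2) := pow_le_pow_right₀ hp1 (by lia)
  calc avgOrder G ≤ (p : ℝ) ^ 2 + ((p : ℝ) ^ (p + 2) - (p : ℝ) ^ 2) / H.index :=
        avgOrder_le_add_div_index H (fun g hg => by exact_mod_cast hout g hg)
          (fun g hg => by exact_mod_cast hin g hg)
    _ ≤ (p : ℝ) ^ 2 + ((p : ℝ) ^ (p + 2) - (p : ℝ) ^ 2) / (p : ℝ) ^ p := by
        gcongr
        exact_mod_cast hindex
    _ = (p : ℝ) ^ 2 - (p : ℝ) ^ ((2 : ℤ) - (p : ℤ)) + (p : ℝ) ^ 2 := by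
        rw [zpow_sub₀ hp0.ne', zpow_natCast, zpow_ofNat, pow_add]
        field_simp
        ring
end

section
/- For every real number C > 0 there exists N such that every finite nilpotent group G with |G| ≥ N satisfies k(G) > C · d(|G|). (Equivalently, k(G)/d(|G|) → ∞ as |G| → ∞ over finite nilpotent groups G.) -/
section Action

variable {H A : Type*} [Group H] [AddCommGroup A] [DistribMulAction H A]

/-- The endomorphism `a ↦ h • a - a`. -/
def smulSubSelf (A : Type*) [AddCommGroup A] [DistribMulAction H A] (h : H) : A →+ A :=
  DistribSMul.toAddMonoidHom A h - AddMonoidHom.id A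

@[simp] lemma smulSubSelf_apply (h : H) (a : A) : smulSubSelf A h a = h • a - a := rfl

/-- The index of `[A, h] + B` in `A`. -/
noncomputable def coinvIndex (B : AddSubgroup A) (h : H) : ℕ :=
  ((smulSubSelf A h).range ⊔ B).index

/-- The action induced on the quotient by an invariant subgroup. -/
@[reducible] def quotientDistribMulAction (B : AddSubgroup A)
    (hB : ∀ (h : H), ∀ b ∈ B, h • b ∈ B) : DistribMulAction H (A ⧸ B) where
  smul h := QuotientAddGroup.map B B (DistribSMul.toAddMonoidHom A h) (hB h)
  one_smul x := by
    induction x using QuotientAddGroup.induction_on with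
    | H a => exact congrArg _ (one_smul H a)
  mul_smul g h x := by
    induction x using QuotientAddGroup.induction_on with
    | H a => exact congrArg _ (mul_smul g h a)
  smul_zero h := map_zero _
  smul_add h := map_add _

lemma card_ker_eq_index_range [Finite A] (f : A →+ A) :
    Nat.card f.ker = f.range.index := by
  have h1 := f.ker.card_mul_index
  have h2 := f.range.card_mul_index
  rw [AddSubgroup.index_ker] at h1
  have : 0 < Nat.card f.range := Nat.card_pos
  nlinarith

lemma card_fixedBy_eq_coinvIndex {A' : Type*} [AddCommGroup A'] [DistribMulAction H A'] [Finite A']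
    (π : A →+ A') (hπ : Function.Surjective π) (he : ∀ (h : H) a, π (h • a) = h • π a) (h : H) :
    Nat.card (MulAction.fixedBy A' h) = coinvIndex π.ker h := by
  have h1 : Nat.card (MulAction.fixedBy A' h) = Nat.card (smulSubSelf A' h).ker := by
    refine Nat.card_congr (Equiv.subtypeEquivRight fun x => ?_)
    simp [AddMonoidHom.mem_ker, sub_eq_zero]
  have h2 : (smulSubSelf A' h).range = (smulSubSelf A h).range.map π := by
    ext x
    constructor
    · rintro ⟨y, rfl⟩
      obtain ⟨a, rfl⟩ := hπ y
      exact ⟨_, ⟨a, rfl⟩, by simp [he]⟩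
    · rintro ⟨_, ⟨a, rfl⟩, rfl⟩
      exact ⟨π a, by simp [he]⟩
  rw [h1, card_ker_eq_index_range, h2, AddSubgroup.index_map, AddMonoidHom.range_eq_top.2 hπ]
  simp [coinvIndex]

lemma sum_coinvIndex [Fintype H] {A' : Type*} [AddCommGroup A'] [DistribMulAction H A'] [Finite A']
    (π : A →+ A') (hπ : Function.Surjective π) (he : ∀ (h : H) a, π (h • a) = h • π a) :
    ∑ h : H, coinvIndex π.ker h =
      Nat.card (Quotient (MulAction.orbitRel H A')) * Nat.card H := by
  classical
  have := Fintype.ofFinite A'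
  have := Fintype.ofFinite (Quotient (MulAction.orbitRel H A'))
  rw [Nat.card_eq_fintype_card, Nat.card_eq_fintype_card,
    ← MulAction.sum_card_fixedBy_eq_card_orbits_mul_card_group]
  refine Finset.sum_congr rfl fun h _ => ?_
  rw [← card_fixedBy_eq_coinvIndex π hπ he, Nat.card_eq_fintype_card]

lemma sum_coinvIndex_add_card_le [Fintype H] [Finite A] {B C : AddSubgroup A} (hlt : B < C)
    (hB : ∀ (h : H), ∀ b ∈ B, h • b ∈ B) (hC : ∀ (h : H), ∀ b ∈ C, h • b ∈ C) :
    ∑ h : H, coinvIndex C h + Nat.card H ≤ ∑ h : H, coinvIndex B h := by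
  let _ := quotientDistribMulAction B hB
  let _ := quotientDistribMulAction C hC
  have e1 := sum_coinvIndex (H := H) (QuotientAddGroup.mk' B) (QuotientAddGroup.mk'_surjective B)
    (fun _ _ => rfl)
  have e2 := sum_coinvIndex (H := H) (QuotientAddGroup.mk' C) (QuotientAddGroup.mk'_surjective C)
    (fun _ _ => rfl)
  rw [QuotientAddGroup.ker_mk'] at e1 e2
  rw [e1, e2, ← Nat.succ_mul]
  refine Nat.mul_le_mul_right _ ?_
  let φ : Quotient (MulAction.orbitRel H (A ⧸ B)) → Quotient (MulAction.orbitRel H (A ⧸ C)) :=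
    Quotient.map (QuotientAddGroup.map B C (AddMonoidHom.id A) hlt.le) (by
      rintro _ x ⟨h, rfl⟩
      induction x using QuotientAddGroup.induction_on with
      | H a => exact ⟨h, rfl⟩)
  have hs : Function.Surjective φ := by
    intro x
    induction x using Quotient.inductionOn with
    | h x =>
      induction x using QuotientAddGroup.induction_on with
      | H a => exact ⟨Quotient.mk _ (a : A ⧸ B), rfl⟩
  have hni : ¬ Function.Injective φ := by
    intro hi
    obtain ⟨c, hcC, hcB⟩ := Set.exists_of_ssubset hlt
    have : φ (Quotient.mk _ (c : A ⧸ B)) = φ (Quotient.mk _ ((0 : A) : A ⧸ B)) := by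
      have : ((c : A) : A ⧸ C) = ((0 : A) : A ⧸ C) := by
        simpa using hcC
      exact congrArg (Quotient.mk _) this
    obtain ⟨h, hh⟩ := Quotient.exact (hi this)
    have h0 : h • ((0 : A) : A ⧸ B) = 0 := smul_zero h
    have : ((c : A) : A ⧸ B) = 0 := by rw [← h0]; exact hh.symm
    exact hcB (by simpa using this)
  by_contra hcon
  have hle : Nat.card (Quotient (MulAction.orbitRel H (A ⧸ B))) ≤
    Nat.card (Quotient (MulAction.orbitRel H (A ⧸ C))) := by omega
  exact hni (Nat.bijective_iff_surjective_and_card φ |>.2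
    ⟨hs, le_antisymm hle (Nat.card_le_card_of_surjective φ hs)⟩).1

lemma exists_invariant_between {p : ℕ} [hp : Fact p.Prime] (hH : IsPGroup p H) [Finite A] {v : ℕ}
    (hA : Nat.card A = p ^ v) {B C : AddSubgroup A} (hlt : B < C)
    (hB : ∀ (h : H), ∀ b ∈ B, h • b ∈ B) (hC : ∀ (h : H), ∀ b ∈ C, h • b ∈ C) :
    ∃ D : AddSubgroup A, B < D ∧ D ≤ C ∧ (∀ (h : H), ∀ b ∈ D, h • b ∈ D) ∧
      Nat.card D ≤ p * Nat.card B := by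
  let _ := quotientDistribMulAction B hB
  let S : SubMulAction H (A ⧸ B) :=
    { carrier := C.map (QuotientAddGroup.mk' B)
      smul_mem' := by
        rintro h _ ⟨c, hc, rfl⟩
        exact ⟨h • c, hC h c hc, rfl⟩ }
  have hScard : Nat.card S = Nat.card (C.map (QuotientAddGroup.mk' B)) := rfl
  have hpS : p ∣ Nat.card S := by
    rw [hScard]
    have hd : Nat.card (C.map (QuotientAddGroup.mk' B)) ∣ p ^ v := by
      rw [← hA]
      exact (AddSubgroup.card_addSubgroup_dvd_card _).trans
        (AddSubgroup.card_eq_card_quotient_mul_card_addSubgroup B ▸ Dvd.intro _ rfl)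
    obtain ⟨k, -, hk⟩ := (Nat.dvd_prime_pow hp.out).1 hd
    rw [hk]
    refine dvd_pow_self p ?_
    rintro rfl
    have : C.map (QuotientAddGroup.mk' B) = ⊥ := AddSubgroup.card_eq_one.1 (by simpa using hk)
    rw [AddSubgroup.map_eq_bot_iff, QuotientAddGroup.ker_mk'] at this
    exact absurd this (not_le_of_gt hlt)
  have h0 : (0 : A ⧸ B) ∈ S := ⟨0, C.zero_mem, rfl⟩
  have hfix0 : (⟨0, h0⟩ : S) ∈ MulAction.fixedPoints H S := fun h => Subtype.ext (smul_zero h)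
  obtain ⟨⟨x, hxS⟩, hxfix, hne⟩ :=
    hH.exists_fixed_point_of_prime_dvd_card_of_fixed_point S hpS hfix0
  obtain ⟨c, hcC, rfl⟩ := hxS
  have hcB : c ∉ B := by
    intro hc
    exact hne (Subtype.ext ((QuotientAddGroup.eq_zero_iff c).2 hc).symm)
  have hcfix : ∀ h : H, h • c - c ∈ B := by
    intro h
    have := congrArg Subtype.val (hxfix h)
    have h2 : ((h • c : A) : A ⧸ B) = (c : A ⧸ B) := this
    have := (QuotientAddGroup.eq_iff_sub_mem).1 h2
    exact this
  -- the last `p`-power multiple of `c` outside `B`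
  have hex : ∃ k, p ^ k • c ∈ B := ⟨v, by
    have : p ^ v • c = 0 := by rw [← hA]; exact card_nsmul_eq_zero'
    rw [this]; exact B.zero_mem⟩
  classical
  obtain ⟨k, hk⟩ : ∃ k, Nat.find hex = k + 1 :=
    Nat.exists_eq_succ_of_ne_zero fun h => hcB (by simpa [h] using Nat.find_spec hex)
  set d := p ^ k • c with hd
  have hdB : d ∉ B := Nat.find_min hex (m := k) (by omega)
  have hpd : p • d ∈ B := by
    have := Nat.find_spec hex
    rwa [hk, pow_succ', mul_smul] at this
  have hdC : d ∈ C := C.nsmul_mem hcC _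
  have hdfix : ∀ h : H, h • d - d ∈ B := by
    intro h
    have : h • d - d = p ^ k • (h • c - c) := by
      rw [hd, smul_sub, smul_comm]
    rw [this]
    exact B.nsmul_mem (hcfix h) _
  refine ⟨B ⊔ AddSubgroup.zmultiples d, ?_, ?_, ?_, ?_⟩
  · refine lt_of_le_of_ne le_sup_left fun h => hdB ?_
    rw [h]
    exact (le_sup_right : _ ≤ B ⊔ _) (AddSubgroup.mem_zmultiples d)
  · exact sup_le hlt.le (by simpa using hdC)
  · intro h b hb
    obtain ⟨b', hb', z, hz, rfl⟩ := AddSubgroup.mem_sup.1 hb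
    obtain ⟨n, rfl⟩ := hz
    have : h • (b' + n • d) = (h • b' + n • (h • d - d)) + n • d := by
      rw [smul_add, smul_comm h n d, smul_sub]; abel
    simp only
    rw [this]
    exact AddSubgroup.mem_sup.2 ⟨_, B.add_mem (hB h b' hb') (B.zsmul_mem (hdfix h) n), _,
      ⟨n, rfl⟩, rfl⟩
  · have hsurj : ∀ x ∈ B ⊔ AddSubgroup.zmultiples d, ∃ (i : Fin p) (b : B), x = i.1 • d + b := by
      intro x hx
      obtain ⟨b', hb', z, ⟨n, rfl⟩, rfl⟩ := AddSubgroup.mem_sup.1 hx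
      have hp0 : (0 : ℤ) < p := by exact_mod_cast hp.out.pos
      refine ⟨⟨(n % p).toNat, ?_⟩, ⟨b' + (n / p) • (p • d), B.add_mem hb' (B.zsmul_mem hpd _)⟩, ?_⟩
      · have := Int.emod_lt_of_pos n hp0
        have := Int.emod_nonneg n hp0.ne'
        omega
      · have h1 : (((n % p).toNat : ℕ) : ℤ) = n % p :=
          Int.toNat_of_nonneg (Int.emod_nonneg n hp0.ne')
        have h2 : (n % p).toNat • d = (n % p) • d := by rw [← natCast_zsmul, h1]
        have h3 : n • d = (n % p) • d + (n / p) • (p • d) := by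
          rw [← natCast_zsmul, smul_smul, ← add_smul, mul_comm, Int.emod_add_mul_ediv]
        simp only [h2, h3]
        abel
    choose i b hib using hsurj
    have : Nat.card (Fin p × B) = p * Nat.card B := by rw [Nat.card_prod, Nat.card_fin]
    rw [← this]
    refine Nat.card_le_card_of_injective (fun x => (i x.1 x.2, b x.1 x.2)) ?_
    rintro ⟨x, hx⟩ ⟨y, hy⟩ hxy
    simp only [Prod.mk.injEq] at hxy
    apply Subtype.ext
    simp only
    rw [hib x hx, hib y hy, hxy.1, hxy.2]

lemma sum_coinvIndex_add_log_le {p : ℕ} [hp : Fact p.Prime] [Fintype H] (hH : IsPGroup p H)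
    [Finite A] {v : ℕ} (hA : Nat.card A = p ^ v) (n : ℕ) {B C : AddSubgroup A} (hle : B ≤ C)
    (hB : ∀ (h : H), ∀ b ∈ B, h • b ∈ B) (hC : ∀ (h : H), ∀ b ∈ C, h • b ∈ C)
    (hn : p ^ n * Nat.card B ≤ Nat.card C) :
    ∑ h : H, coinvIndex C h + n * Nat.card H ≤ ∑ h : H, coinvIndex B h := by
  induction n generalizing B with
  | zero =>
    simp only [zero_mul, add_zero]
    refine Finset.sum_le_sum fun h _ => ?_
    exact Nat.le_of_dvd (Nat.pos_of_ne_zero AddSubgroup.index_ne_zero_of_finite)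
      (AddSubgroup.index_dvd_of_le (sup_le_sup_left hle _))
  | succ n ih =>
    have hpos : 0 < Nat.card B := Nat.card_pos
    have hlt : B < C := by
      refine lt_of_le_of_ne hle ?_
      rintro rfl
      have : 1 < p ^ (n + 1) := Nat.one_lt_pow (by omega) hp.out.one_lt
      nlinarith
    obtain ⟨D, hBD, hDC, hD, hcard⟩ := exists_invariant_between hH hA hlt hB hC
    have h1 := ih hDC hD (by
      refine le_trans ?_ hn
      rw [pow_succ, mul_assoc]
      exact Nat.mul_le_mul_left _ hcard)
    have h2 := sum_coinvIndex_add_card_le hBD hB hD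
    have : (n + 1) * Nat.card H = n * Nat.card H + Nat.card H := by ring
    omega

/-- A `p`-group acting on a finite abelian `p`-group has invariant subgroups of each order. -/
lemma exists_invariant_card_eq {p : ℕ} [hp : Fact p.Prime] (hH : IsPGroup p H) [Finite A] {v : ℕ}
    (hA : Nat.card A = p ^ v) {n : ℕ} (hn : n ≤ v) :
    ∃ B : AddSubgroup A, (∀ (h : H), ∀ b ∈ B, h • b ∈ B) ∧ Nat.card B = p ^ n := by
  induction n with
  | zero => exact ⟨⊥, by simp, by simp⟩
  | succ n ih =>
    obtain ⟨B, hB, hc⟩ := ih (by omega)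
    have hlt : B < ⊤ := by
      rw [lt_top_iff_ne_top]
      rintro rfl
      rw [AddSubgroup.card_top, hA] at hc
      have := Nat.pow_right_injective hp.out.two_le hc
      omega
    obtain ⟨D, hBD, -, hD, hcard⟩ := exists_invariant_between hH hA hlt hB (by simp)
    refine ⟨D, hD, ?_⟩
    obtain ⟨j, -, hj⟩ := (Nat.dvd_prime_pow hp.out).1
      (hA ▸ AddSubgroup.card_addSubgroup_dvd_card D)
    have h1 : Nat.card B < Nat.card D := by
      refine lt_of_le_of_ne (Nat.card_le_card_of_injective _
        (AddSubgroup.inclusion_injective hBD.le)) fun h => hBD.ne ?_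
      exact AddSubgroup.eq_of_le_of_card_ge hBD.le h.ge
    rw [hj] at h1 hcard ⊢
    rw [hc] at h1 hcard
    rw [← pow_succ'] at hcard
    have := (Nat.pow_lt_pow_iff_right hp.out.one_lt).1 h1
    have := (Nat.pow_le_pow_iff_right hp.out.one_lt).1 hcard
    congr 1; omega

lemma card_comap_le_card_ker_mul [Finite A] (g : A →+ A) (K : AddSubgroup A) :
    Nat.card (K.comap g) ≤ Nat.card g.ker * Nat.card K := by
  let φ : K.comap g →+ A := g.comp (K.comap g).subtype
  have h1 := φ.ker.card_mul_index
  rw [AddSubgroup.index_ker] at h1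
  rw [← h1]
  refine Nat.mul_le_mul ?_ ?_
  · refine Nat.card_le_card_of_injective (fun x : φ.ker => (⟨x.1.1, x.2⟩ : g.ker)) ?_
    intro x y hxy
    exact Subtype.ext (Subtype.ext (congrArg (fun z : g.ker => z.1) hxy))
  · refine Nat.card_le_card_of_injective (AddSubgroup.inclusion (H := φ.range) (K := K) ?_)
      (AddSubgroup.inclusion_injective _)
    rintro _ ⟨x, rfl⟩
    exact x.2

lemma card_le_card_ker_pow [Finite A] (f : A →+ A) (n : ℕ) (K : AddSubgroup A)
    (hK : ∀ a ∈ K, f^[n] a = 0) : Nat.card K ≤ Nat.card f.ker ^ n := by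
  induction n generalizing K with
  | zero =>
    have : K = ⊥ := (AddSubgroup.eq_bot_iff_forall _).2 hK
    simp [this]
  | succ n ih =>
    have h1 : Nat.card (K.map f) ≤ Nat.card f.ker ^ n := by
      refine ih _ ?_
      rintro _ ⟨a, ha, rfl⟩
      exact hK a ha
    have h2 : Nat.card K ≤ Nat.card ((K.map f).comap f) :=
      Nat.card_le_card_of_injective _
        (AddSubgroup.inclusion_injective (AddSubgroup.le_comap_map f K))
    rw [pow_succ']
    exact h2.trans ((card_comap_le_card_ker_mul _ _).trans (Nat.mul_le_mul_left _ h1))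

lemma iterate_smulSubSelf_eq_zero {p : ℕ} (hp : p.Prime) (hpA : ∀ a : A, p • a = 0) (y : H)
    (n : ℕ) (hy : ∀ a : A, y ^ p ^ n • a = a) (a : A) :
    (smulSubSelf A y)^[p ^ n] a = 0 := by
  let φ : AddMonoid.End A := DistribMulAction.toAddMonoidEnd H A y
  let δ : AddMonoid.End A := smulSubSelf A y
  have hφ : φ = δ + 1 := by
    ext a; exact (sub_add_cancel (y • a) a).symm
  have h1 : φ ^ p ^ n = 1 := by
    have : φ ^ p ^ n = DistribMulAction.toAddMonoidEnd H A (y ^ p ^ n) := (map_pow _ _ _).symm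
    rw [this]; ext a; exact hy a
  have hp0 : (p : AddMonoid.End A) = 0 := by
    ext a; simpa using hpA a
  have hδ : δ ^ p ^ n = 0 := by
    obtain ⟨r, hr⟩ := (Commute.one_right δ).exists_add_pow_prime_pow_eq hp n
    rw [← hφ, h1, one_pow, hp0] at hr
    simpa using hr
  have := congrArg (fun f : AddMonoid.End A => f a) hδ
  rw [AddMonoid.End.coe_pow] at this
  exact this

lemma coinvIndex_le_card_ker [Finite A] (B : AddSubgroup A) (y : H) :
    coinvIndex B y ≤ Nat.card (smulSubSelf A y).ker := by
  rw [card_ker_eq_index_range]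
  exact Nat.le_of_dvd (Nat.pos_of_ne_zero AddSubgroup.index_ne_zero_of_finite)
    (AddSubgroup.index_dvd_of_le le_sup_left)

lemma coinvIndex_le_index [Finite A] (B : AddSubgroup A) (y : H) :
    coinvIndex B y ≤ B.index :=
  Nat.le_of_dvd (Nat.pos_of_ne_zero AddSubgroup.index_ne_zero_of_finite)
    (AddSubgroup.index_dvd_of_le le_sup_right)

open Classical in
/-- For an elementary abelian section, nontrivial `p ^ a`-th powers are frequent on average. -/
lemma mul_card_le_sum_card_ker {p : ℕ} [hp : Fact p.Prime] [Fintype H] (hH : IsPGroup p H)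
    [Finite A] {v : ℕ} (hA : Nat.card A = p ^ v) (hpA : ∀ a : A, p • a = 0)
    {k L a : ℕ} (hk : k ≤ p ^ L) (hL : L * p ^ (a + 1) ≤ v)
    (hsum : ∑ y : H, Nat.card (smulSubSelf A y).ker ≤ k * Nat.card H) :
    v / p ^ (a + 1) * Nat.card H ≤
      ∑ y : H, if ∃ x : A, y ^ p ^ a • x ≠ x then Nat.card (smulSubSelf A y).ker else 0 := by
  have hp2 := hp.out.two_le
  have hpp : 0 < p ^ (a + 1) := Nat.pow_pos hp.out.pos
  set j := v / p ^ (a + 1) with hj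
  have hjv : j * p ^ (a + 1) ≤ v := Nat.div_mul_le_self _ _
  have hjv' : j ≤ v := le_trans (Nat.le_mul_of_pos_right _ hpp) hjv
  have hLj : L ≤ j := (Nat.le_div_iff_mul_le hpp).2 hL
  obtain ⟨B, hB, hBc⟩ := exists_invariant_card_eq (H := H) hH hA (n := v - j) (by omega)
  have hBi : B.index = p ^ j := by
    have := B.card_mul_index
    rw [hBc, hA] at this
    have h2 : p ^ v = p ^ (v - j) * p ^ j := by rw [← pow_add]; congr 1; omega
    rw [h2] at this
    exact Nat.eq_of_mul_eq_mul_left (Nat.pow_pos hp.out.pos) this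
  have h1 := sum_coinvIndex_add_log_le hH hA j (le_top : B ≤ ⊤) hB (by simp) (by
    rw [hBc, AddSubgroup.card_top, hA, ← pow_add]
    exact Nat.pow_le_pow_right hp.out.pos (by omega))
  have htop : ∑ h : H, coinvIndex (⊤ : AddSubgroup A) h = Nat.card H := by
    simp [coinvIndex]
  rw [htop] at h1
  -- elements acting with small order contribute little
  have h2 : ∀ y : H, p ^ L * coinvIndex B y ≤
      p ^ L * (if ∃ x : A, y ^ p ^ a • x ≠ x then Nat.card (smulSubSelf A y).ker else 0) +
        Nat.card (smulSubSelf A y).ker := by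
    intro y
    split_ifs with hy
    · exact le_add_right (Nat.mul_le_mul_left _ (coinvIndex_le_card_ker B y))
    · push Not at hy
      obtain ⟨f, -, hf⟩ := (Nat.dvd_prime_pow hp.out).1
        (hA ▸ AddSubgroup.card_addSubgroup_dvd_card (smulSubSelf A y).ker)
      have h3 := card_le_card_ker_pow (smulSubSelf A y) (p ^ a) ⊤
        (fun x _ => iterate_smulSubSelf_eq_zero hp.out hpA y a hy x)
      rw [AddSubgroup.card_top, hA, hf, ← pow_mul, Nat.pow_le_pow_iff_right hp.out.one_lt] at h3
      have h4 : 2 * j ≤ f := by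
        have : (p * j) * p ^ a ≤ f * p ^ a := by
          calc (p * j) * p ^ a = j * p ^ (a + 1) := by ring
            _ ≤ _ := hjv.trans h3
        have := Nat.le_of_mul_le_mul_right this (Nat.pow_pos hp.out.pos)
        nlinarith
      rw [mul_zero, zero_add, hf]
      calc p ^ L * coinvIndex B y ≤ p ^ L * p ^ j :=
            Nat.mul_le_mul_left _ ((coinvIndex_le_index B y).trans hBi.le)
        _ = p ^ (L + j) := (pow_add _ _ _).symm
        _ ≤ p ^ f := Nat.pow_le_pow_right hp.out.pos (by omega)
  have h3 := Finset.sum_le_sum fun y (_ : y ∈ Finset.univ) => h2 y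
  rw [← Finset.mul_sum, Finset.sum_add_distrib, ← Finset.mul_sum] at h3
  have h4 : k * Nat.card H ≤ p ^ L * Nat.card H := Nat.mul_le_mul_right _ hk
  have hpL : 0 < p ^ L := Nat.pow_pos hp.out.pos
  refine Nat.le_of_mul_le_mul_left (?_ : p ^ L * _ ≤ p ^ L * _) hpL
  have h5 := Nat.mul_le_mul_left (p ^ L) h1
  rw [mul_add] at h5
  omega

/-- If a `p`-group `H` acts on an elementary abelian group of order `p ^ v`, with `v` large compared
to the average of a function `c` that behaves like centralizer orders, then this average is
large. -/
lemma mul_le_of_elementary {p : ℕ} [hp : Fact p.Prime] [Fintype H] (hH : IsPGroup p H)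
    [Finite A] {v : ℕ} (hA : Nat.card A = p ^ v) (hpA : ∀ a : A, p • a = 0) (c : H → ℕ)
    (hc : ∀ y, Nat.card (smulSubSelf A y).ker ≤ c y)
    (hc' : ∀ (y : H) (a : ℕ), (∃ x : A, y ^ p ^ a • x ≠ x) →
      p ^ a * Nat.card (smulSubSelf A y).ker ≤ c y)
    {k L R : ℕ} (hk : k ≤ p ^ L) (hL : 1 ≤ L) (hLR : L * p ^ R ≤ v)
    (hsum : ∑ y : H, c y = k * Nat.card H) :
    R * v ≤ 4 * p * k := by
  classical
  have hp2 := hp.out.two_le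
  have key : ∀ y : H, ∀ n, ∑ a ∈ Finset.range n, p ^ a *
      (if ∃ x : A, y ^ p ^ a • x ≠ x then Nat.card (smulSubSelf A y).ker else 0) ≤ 2 * c y := by
    intro y n
    induction n with
    | zero => simp
    | succ n ih =>
      by_cases hy : ∃ x : A, y ^ p ^ n • x ≠ x
      · have hgeom : ∑ a ∈ Finset.range (n + 1), p ^ a ≤ 2 * p ^ n := by
          clear ih hy hsum hLR
          induction n with
          | zero => simp
          | succ n ih =>
            rw [Finset.sum_range_succ, pow_succ]
            nlinarith [Nat.mul_le_mul_left (p ^ n) hp2]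
        calc _ ≤ ∑ a ∈ Finset.range (n + 1), p ^ a * Nat.card (smulSubSelf A y).ker := by
              refine Finset.sum_le_sum fun a _ => Nat.mul_le_mul_left _ ?_
              split_ifs <;> simp
          _ ≤ 2 * p ^ n * Nat.card (smulSubSelf A y).ker := by
              rw [← Finset.sum_mul]; exact Nat.mul_le_mul_right _ hgeom
          _ ≤ 2 * c y := by rw [mul_assoc]; exact Nat.mul_le_mul_left _ (hc' y n hy)
      · rw [Finset.sum_range_succ, if_neg hy]; simpa using ih
  have h1 : ∀ a ∈ Finset.range R, v * Nat.card H ≤ 2 * p * ∑ y : H, p ^ a *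
      (if ∃ x : A, y ^ p ^ a • x ≠ x then Nat.card (smulSubSelf A y).ker else 0) := by
    intro a ha
    have haR : p ^ (a + 1) ≤ p ^ R :=
      Nat.pow_le_pow_right hp.out.pos (Finset.mem_range.1 ha)
    have hpp : 0 < p ^ (a + 1) := Nat.pow_pos hp.out.pos
    have hLa : L * p ^ (a + 1) ≤ v := (Nat.mul_le_mul_left _ haR).trans hLR
    have := mul_card_le_sum_card_ker (H := H) hH hA hpA hk hLa
      (hsum ▸ Finset.sum_le_sum fun y _ => hc y)
    rw [← Finset.mul_sum]
    refine le_trans ?_ (Nat.mul_le_mul_left (2 * p) (Nat.mul_le_mul_left (p ^ a) this))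
    have h2 : v ≤ 2 * (p ^ (a + 1) * (v / p ^ (a + 1))) := by
      have h3 := Nat.div_add_mod v (p ^ (a + 1))
      have h4 := Nat.mod_lt v hpp
      have h5 : 1 ≤ v / p ^ (a + 1) := hL.trans ((Nat.le_div_iff_mul_le hpp).2 hLa)
      nlinarith
    calc v * Nat.card H ≤ 2 * (p ^ (a + 1) * (v / p ^ (a + 1))) * Nat.card H :=
          Nat.mul_le_mul_right _ h2
      _ = _ := by ring
  have h2 := Finset.sum_le_sum h1
  rw [Finset.sum_const, Finset.card_range, smul_eq_mul, ← Finset.mul_sum, Finset.sum_comm] at h2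
  have h3 := Finset.sum_le_sum fun y (_ : y ∈ Finset.univ) => key y R
  rw [← Finset.mul_sum, hsum] at h3
  have h4 := h2.trans (Nat.mul_le_mul_left _ h3)
  have hH0 : 0 < Nat.card H := Nat.card_pos
  refine Nat.le_of_mul_le_mul_right (?_ : _ * Nat.card H ≤ _ * Nat.card H) hH0
  calc _ = R * (v * Nat.card H) := by ring
    _ ≤ _ := h4
    _ = _ := by ring

lemma sum_pow_smul_sub_mem_range (y : H) (a : A) (n : ℕ) :
    ∑ i ∈ Finset.range n, y ^ i • a - n • a ∈ (smulSubSelf A y).range := by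
  have h : ∀ i, y ^ i • a - a ∈ (smulSubSelf A y).range := by
    intro i
    induction i with
    | zero => simp
    | succ i ih =>
      have h1 : y ^ (i + 1) • a - a = smulSubSelf A y (y ^ i • a) + (y ^ i • a - a) := by
        rw [pow_succ', mul_smul, smulSubSelf_apply]; abel
      rw [h1]
      exact add_mem ⟨_, rfl⟩ ih
  have h2 : ∑ i ∈ Finset.range n, y ^ i • a - n • a = ∑ i ∈ Finset.range n, (y ^ i • a - a) := by
    simp [Finset.sum_sub_distrib]
  rw [h2]
  exact sum_mem fun i _ => h i

lemma smul_sum_pow_smul (y : H) (a : A) (n : ℕ) (hy : y ^ n • a = a) :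
    y • ∑ i ∈ Finset.range n, y ^ i • a = ∑ i ∈ Finset.range n, y ^ i • a := by
  have h1 := Finset.sum_range_succ (fun i => y ^ i • a) n
  rw [Finset.sum_range_succ', hy, pow_zero, one_smul, add_left_inj] at h1
  rw [Finset.smul_sum, ← h1]
  simp only [pow_succ', mul_smul]

/-- If `y ^ p ^ r` acts trivially, a `p ^ r`-multiple outside `[A, y] + A[p ^ (2 r)]` forces
`[A, y]` to be small compared with `[A, y] + A[p ^ (2 r)]`. -/
lemma pow_mul_coinvIndex_le_card_ker {p : ℕ} [hp : Fact p.Prime] [Finite A] {v r : ℕ}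
    (hA : Nat.card A = p ^ v) (y : H) (hy : ∀ a : A, y ^ p ^ r • a = a) (B : AddSubgroup A)
    (hB : ∀ a : A, p ^ (2 * r) • a = 0 → a ∈ B) (a₀ : A)
    (ha₀ : p ^ r • a₀ ∉ (smulSubSelf A y).range ⊔ B) :
    p ^ r * coinvIndex B y ≤ Nat.card (smulSubSelf A y).ker := by
  set K := (smulSubSelf A y).range ⊔ B with hK
  have hrK : (smulSubSelf A y).range ≤ K := le_sup_left
  obtain ⟨a, haK, hpaK⟩ : ∃ a : A, p ^ r • a ∉ K ∧ p • (p ^ r • a) ∈ K := by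
    have hex : ∃ k, p ^ k • (p ^ r • a₀) ∈ K := ⟨v, by
      have : p ^ v • (p ^ r • a₀) = 0 := by rw [← hA]; exact card_nsmul_eq_zero'
      rw [this]; exact K.zero_mem⟩
    classical
    obtain ⟨k, hk⟩ : ∃ k, Nat.find hex = k + 1 :=
      Nat.exists_eq_succ_of_ne_zero fun h => ha₀ (by simpa [h] using Nat.find_spec hex)
    refine ⟨p ^ k • a₀, ?_, ?_⟩
    · rw [smul_comm]; exact Nat.find_min hex (m := k) (by omega)
    · have := Nat.find_spec hex
      rw [hk, pow_succ', mul_smul] at this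
      rwa [smul_comm (p ^ r) (p ^ k)]
  set w := ∑ i ∈ Finset.range (p ^ r), y ^ i • a with hw
  have hwa : w - p ^ r • a ∈ (smulSubSelf A y).range := sum_pow_smul_sub_mem_range y a _
  have hyw : y • w = w := smul_sum_pow_smul y a _ (hy a)
  have hwK : w ∉ K := by
    intro h
    refine haK ?_
    have := K.sub_mem h (hrK hwa)
    rwa [sub_sub_cancel] at this
  have hpw : p • w ∈ K := by
    have h1 := K.add_mem (K.nsmul_mem (hrK hwa) p) hpaK
    rwa [smul_sub, sub_add_cancel] at h1
  have hsw : p ^ r • w ∉ (smulSubSelf A y).range := by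
    rintro ⟨z, hz⟩
    have h1 : ∀ i : ℕ, y ^ i • z = z + i • (p ^ r • w) := by
      intro i
      induction i with
      | zero => simp
      | succ i ih =>
        have h2 : y • z = z + p ^ r • w := by rw [← hz, smulSubSelf_apply]; abel
        rw [pow_succ', mul_smul, ih, smul_add, smul_comm y i, smul_comm y (p ^ r), hyw, h2,
          succ_nsmul]
        abel
    have h2 := h1 (p ^ r)
    rw [hy, left_eq_add, smul_smul, ← pow_add, ← two_mul] at h2
    exact hwK ((le_sup_right : B ≤ K) (hB w h2))
  -- compute in the quotient by `[A, y]`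
  let π := QuotientAddGroup.mk' (smulSubSelf A y).range
  have hπ : Function.Surjective π := QuotientAddGroup.mk'_surjective _
  have hcard : Nat.card (K.map π) * coinvIndex B y = Nat.card (smulSubSelf A y).ker := by
    rw [card_ker_eq_index_range]
    have h1 := (K.map π).card_mul_index
    rw [AddSubgroup.index_map_eq K hπ (by rw [QuotientAddGroup.ker_mk']; exact hrK)] at h1
    exact h1
  rw [← hcard]
  refine Nat.mul_le_mul_right _ ?_
  obtain ⟨t, -, ht⟩ : ∃ t ≤ v, addOrderOf (π w) = p ^ t := by
    refine (Nat.dvd_prime_pow hp.out).1 (addOrderOf_dvd_of_nsmul_eq_zero ?_)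
    rw [← map_nsmul, ← hA, card_nsmul_eq_zero', map_zero]
  have htr : r < t := by
    by_contra! h
    refine hsw ((QuotientAddGroup.eq_zero_iff _).1 ?_)
    change π (p ^ r • w) = 0
    rw [map_nsmul]
    exact addOrderOf_dvd_iff_nsmul_eq_zero.1 (ht ▸ pow_dvd_pow p h)
  have hpw' : addOrderOf (p • π w) = p ^ (t - 1) := by
    rw [addOrderOf_nsmul' _ hp.out.ne_zero, ht, Nat.gcd_eq_right (dvd_pow_self p (by omega))]
    exact Nat.div_eq_of_eq_mul_left hp.out.pos (by rw [← pow_succ]; congr 1; omega)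
  have hle : AddSubgroup.zmultiples (p • π w) ≤ K.map π := by
    rw [AddSubgroup.zmultiples_le]
    exact ⟨p • w, hpw, map_nsmul _ _ _⟩
  calc p ^ r ≤ p ^ (t - 1) := Nat.pow_le_pow_right hp.out.pos (by omega)
    _ = Nat.card (AddSubgroup.zmultiples (p • π w)) := by rw [Nat.card_zmultiples, hpw']
    _ ≤ _ := Nat.card_le_card_of_injective _ (AddSubgroup.inclusion_injective hle)

/-- If a `p`-group `H` acts on an abelian `p`-group of large exponent, then the average of a
function `c` that behaves like centralizer orders is large. -/
lemma mul_le_of_large_exponent {p : ℕ} [hp : Fact p.Prime] [Fintype H] (hH : IsPGroup p H)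
    [Finite A] {v : ℕ} (hA : Nat.card A = p ^ v) (c : H → ℕ)
    (hc : ∀ y, Nat.card (smulSubSelf A y).ker ≤ c y)
    (hc' : ∀ (y : H) (a : ℕ), (∃ x : A, y ^ p ^ a • x ≠ x) →
      p ^ a * Nat.card (smulSubSelf A y).ker ≤ c y)
    {k r l : ℕ} (hl : p ^ l ≤ Nat.card (nsmulAddMonoidHom (α := A) (p ^ (3 * r))).range)
    (hsum : ∑ y : H, c y = k * Nat.card H) :
    p ^ r * l ≤ k := by
  classical
  let B₁ : AddSubgroup A := (nsmulAddMonoidHom (α := A) (p ^ (2 * r))).ker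
  let B₀ : AddSubgroup A := (nsmulAddMonoidHom (α := A) (p ^ r)).range ⊔ B₁
  have hB₁ : ∀ (h : H), ∀ b ∈ B₁, h • b ∈ B₁ := by
    intro h b hb
    have hb : p ^ (2 * r) • b = 0 := hb
    change p ^ (2 * r) • (h • b) = 0
    rw [smul_comm, hb, smul_zero]
  have hB₀ : ∀ (h : H), ∀ b ∈ B₀, h • b ∈ B₀ := by
    intro h b hb
    obtain ⟨_, ⟨x, rfl⟩, z, hz, rfl⟩ := AddSubgroup.mem_sup.1 hb
    refine AddSubgroup.mem_sup.2 ⟨_, ⟨h • x, rfl⟩, h • z, hB₁ h z hz, ?_⟩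
    simp only [nsmulAddMonoidHom_apply, smul_add]
    rw [smul_comm]
  have hcard : p ^ l * Nat.card B₁ ≤ Nat.card B₀ := by
    let φ : B₀ →+ A := (nsmulAddMonoidHom (α := A) (p ^ (2 * r))).comp B₀.subtype
    have h1 := φ.ker.card_mul_index
    rw [AddSubgroup.index_ker] at h1
    rw [← h1, mul_comm]
    refine Nat.mul_le_mul ?_ (hl.trans ?_)
    · exact Nat.card_le_card_of_injective
        (fun x : B₁ => (⟨⟨x.1, (le_sup_right : B₁ ≤ B₀) x.2⟩, x.2⟩ : φ.ker))
        fun x y hxy => Subtype.ext (congrArg (fun z : φ.ker => z.1.1) hxy)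
    · refine Nat.card_le_card_of_injective _ (AddSubgroup.inclusion_injective (K := φ.range) ?_)
      rintro _ ⟨x, rfl⟩
      refine ⟨⟨p ^ r • x, (le_sup_left : _ ≤ B₀) ⟨x, rfl⟩⟩, ?_⟩
      change p ^ (2 * r) • (p ^ r • x) = p ^ (3 * r) • x
      rw [smul_smul, ← pow_add]
      congr 2; ring
  have h1 := sum_coinvIndex_add_log_le hH hA l (B := B₁) (C := B₀) le_sup_right hB₁ hB₀ hcard
  have h2 : ∀ y : H, p ^ r * coinvIndex B₁ y ≤ p ^ r * coinvIndex B₀ y + c y := by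
    intro y
    by_cases hy : ∃ x : A, y ^ p ^ r • x ≠ x
    · exact le_add_left ((Nat.mul_le_mul_left _ (coinvIndex_le_card_ker B₁ y)).trans (hc' y r hy))
    · push Not at hy
      by_cases hx : ∃ a₀ : A, p ^ r • a₀ ∉ (smulSubSelf A y).range ⊔ B₁
      · obtain ⟨a₀, ha₀⟩ := hx
        exact le_add_left ((pow_mul_coinvIndex_le_card_ker hA y hy B₁ (fun a ha => ha) a₀ ha₀).trans
          (hc y))
      · push Not at hx
        refine le_add_right (Nat.mul_le_mul_left _ (le_of_eq ?_))
        unfold coinvIndex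
        congr 1
        refine le_antisymm (sup_le_sup_left le_sup_right _)
          (sup_le le_sup_left (sup_le ?_ le_sup_right))
        rintro _ ⟨a, rfl⟩
        exact hx a
  have h3 := Finset.sum_le_sum fun y (_ : y ∈ Finset.univ) => h2 y
  rw [← Finset.mul_sum, Finset.sum_add_distrib, ← Finset.mul_sum, hsum] at h3
  have h4 := Nat.mul_le_mul_left (p ^ r) h1
  rw [mul_add] at h4
  have hH0 : 0 < Nat.card H := Nat.card_pos
  refine Nat.le_of_mul_le_mul_right (?_ : _ * Nat.card H ≤ _ * Nat.card H) hH0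
  rw [mul_assoc]
  omega

/-- If a `p`-group `H` acts on an abelian group of order `p ^ v`, then the average of a function
`c` that behaves like centralizer orders is large compared to `v`. -/
lemma mul_le_or_mul_le {p : ℕ} [hp : Fact p.Prime] [Fintype H] (hH : IsPGroup p H)
    [Finite A] {v : ℕ} (hA : Nat.card A = p ^ v) (c : H → ℕ)
    (hc : ∀ y, Nat.card (smulSubSelf A y).ker ≤ c y)
    (hc' : ∀ (y : H) (a : ℕ), (∃ x : A, y ^ p ^ a • x ≠ x) →
      p ^ a * Nat.card (smulSubSelf A y).ker ≤ c y)
    {k r L R : ℕ} (hr : 1 ≤ r) (hk : k ≤ p ^ L) (hL : 1 ≤ L) (hLR : 6 * r * (L * p ^ R) ≤ v)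
    (hsum : ∑ y : H, c y = k * Nat.card H) :
    p ^ r * v ≤ 2 * k ∨ R * v ≤ 24 * p * r * k := by
  let B : AddSubgroup A := (nsmulAddMonoidHom (α := A) p).range
  have hB : ∀ (h : H), ∀ b ∈ B, h • b ∈ B := by
    rintro h _ ⟨b, rfl⟩
    exact ⟨h • b, smul_comm _ _ _⟩
  obtain ⟨ρ, -, hρ⟩ : ∃ ρ ≤ v, B.index = p ^ ρ :=
    (Nat.dvd_prime_pow hp.out).1 (hA ▸ AddSubgroup.index_dvd_card B)
  have hρ' : Nat.card (nsmulAddMonoidHom (α := A) p).ker = p ^ ρ := by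
    rw [card_ker_eq_index_range]; exact hρ
  set f := nsmulAddMonoidHom (α := A) (p ^ (3 * r)) with hf
  obtain ⟨l, -, hl⟩ : ∃ l ≤ v, Nat.card f.range = p ^ l :=
    (Nat.dvd_prime_pow hp.out).1 (hA ▸ AddSubgroup.card_addSubgroup_dvd_card _)
  have hv : v ≤ l + 3 * r * ρ := by
    have h1 := f.ker.card_mul_index
    rw [AddSubgroup.index_ker, hl, hA] at h1
    have h2 : Nat.card f.ker ≤ (p ^ ρ) ^ (3 * r) := by
      rw [← hρ']
      refine card_le_card_ker_pow _ _ _ fun a ha => ?_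
      have h3 : ∀ n : ℕ, (nsmulAddMonoidHom (α := A) p)^[n] a = p ^ n • a := by
        intro n
        induction n with
        | zero => simp
        | succ n ih =>
          rw [Function.iterate_succ_apply', ih, nsmulAddMonoidHom_apply, smul_smul, pow_succ']
      rw [h3]; exact ha
    have h4 : p ^ v ≤ p ^ (l + 3 * r * ρ) := by
      rw [← h1, pow_add, mul_comm (p ^ l), mul_comm (3 * r), pow_mul]
      exact Nat.mul_le_mul_right _ h2
    exact (Nat.pow_le_pow_iff_right hp.out.one_lt).1 h4
  rcases le_or_gt v (2 * l) with hvl | hvl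
  · left
    have := mul_le_of_large_exponent (H := H) hH hA c hc hc' (r := r) (l := l) hl.ge hsum
    calc p ^ r * v ≤ p ^ r * (2 * l) := Nat.mul_le_mul_left _ hvl
      _ = 2 * (p ^ r * l) := by ring
      _ ≤ _ := by omega
  · right
    have hvρ : v ≤ 6 * r * ρ := by
      have : 6 * r * ρ = 2 * (3 * r * ρ) := by ring
      omega
    let _ := quotientDistribMulAction (H := H) B hB
    have hker : ∀ y : H, Nat.card (smulSubSelf (A ⧸ B) y).ker ≤ Nat.card (smulSubSelf A y).ker := by
      intro y
      have h1 := card_fixedBy_eq_coinvIndex (H := H) (QuotientAddGroup.mk' B)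
        (QuotientAddGroup.mk'_surjective B) (fun _ _ => rfl) y
      have h2 : Nat.card (MulAction.fixedBy (A ⧸ B) y) = Nat.card (smulSubSelf (A ⧸ B) y).ker := by
        refine Nat.card_congr (Equiv.subtypeEquivRight fun x => ?_)
        simp [AddMonoidHom.mem_ker, sub_eq_zero]
      rw [← h2, h1]
      exact coinvIndex_le_card_ker _ y
    have hA' : Nat.card (A ⧸ B) = p ^ ρ := hρ
    have := mul_le_of_elementary (H := H) hH hA'
      (by
        intro x
        induction x using QuotientAddGroup.induction_on with
        | H a => exact (QuotientAddGroup.eq_zero_iff _).2 ⟨a, rfl⟩)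
      c (fun y => (hker y).trans (hc y))
      (by
        rintro y a ⟨x, hx⟩
        induction x using QuotientAddGroup.induction_on with
        | H x =>
          refine (Nat.mul_le_mul_left _ (hker y)).trans (hc' y a ⟨x, fun h => hx ?_⟩)
          exact congrArg (QuotientAddGroup.mk (s := B)) h)
      hk hL (R := R) (by
        refine Nat.le_of_mul_le_mul_left (hLR.trans hvρ) (by omega)) hsum
    calc R * v ≤ R * (6 * r * ρ) := Nat.mul_le_mul_left _ hvρ
      _ = 6 * r * (R * ρ) := by ring
      _ ≤ 6 * r * (4 * p * k) := Nat.mul_le_mul_left _ this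
      _ = _ := by ring

end Action

section Conjugation

variable {G : Type*} [Group G]

open scoped IsMulCommutative in
/-- The conjugation action of a group on a commutative normal subgroup, written additively. -/
@[reducible] def conjDistribMulAction (A : Subgroup G) [A.Normal] [IsMulCommutative A] :
    DistribMulAction G (Additive A) where
  smul g a := Additive.ofMul (MulAut.conjNormal g a.toMul)
  one_smul a := by
    change Additive.ofMul (MulAut.conjNormal 1 a.toMul) = a
    simp
  mul_smul g h a := by
    change Additive.ofMul (MulAut.conjNormal (g * h) a.toMul) =
      Additive.ofMul (MulAut.conjNormal g (MulAut.conjNormal h a.toMul))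
    simp
  smul_zero g := congrArg Additive.ofMul (map_one (MulAut.conjNormal (H := A) g))
  smul_add g a b := congrArg Additive.ofMul (map_mul (MulAut.conjNormal (H := A) g) a.toMul b.toMul)

lemma sum_card_centralizer [Fintype G] :
    ∑ y : G, Nat.card (Subgroup.centralizer {y}) = Nat.card (ConjClasses G) * Nat.card G := by
  rw [← card_comm_eq_card_conjClasses_mul_card, ← Nat.card_sigma]
  refine Nat.card_congr ?_
  exact
    { toFun := fun x => ⟨(x.1, x.2.1), (Subgroup.mem_centralizer_singleton_iff.1 x.2.2).symm⟩
      invFun := fun x => ⟨x.1.1, x.1.2, Subgroup.mem_centralizer_singleton_iff.2 x.2.symm⟩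
      left_inv := fun x => rfl
      right_inv := fun x => rfl }

lemma pow_mul_card_le_card_centralizer {p : ℕ} [hp : Fact p.Prime] [Finite G] (hG : IsPGroup p G)
    (A : Subgroup G) [A.Normal] (y : G) (n : ℕ) (hy : y ^ p ^ n ∉ A) :
    p ^ n * Nat.card (A ⊓ Subgroup.centralizer {y} : Subgroup G) ≤
      Nat.card (Subgroup.centralizer {y}) := by
  have hc : Nat.card (Fin (p ^ n) × (A ⊓ Subgroup.centralizer {y} : Subgroup G)) =
    p ^ n * Nat.card (A ⊓ Subgroup.centralizer {y} : Subgroup G) := by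
    rw [Nat.card_prod, Nat.card_fin]
  rw [← hc]
  have hyc : y ∈ Subgroup.centralizer {y} := Subgroup.mem_centralizer_singleton_iff.2 rfl
  have key : ∀ i j : ℕ, i < p ^ n → j < p ^ n → y ^ i * (y ^ j)⁻¹ ∈ A → i ≤ j := by
    intro i j hi hj hmem
    by_contra! hlt
    have h1 : ((y : G) : G ⧸ A) ^ (i - j) = 1 := by
      rw [← QuotientGroup.mk_pow, QuotientGroup.eq_one_iff]
      rwa [pow_sub _ hlt.le]
    obtain ⟨s, hs⟩ := (IsPGroup.iff_orderOf.1 (hG.to_quotient A)) (y : G ⧸ A)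
    have h2 : p ^ s ∣ i - j := hs ▸ orderOf_dvd_of_pow_eq_one h1
    have h3 : p ^ s < p ^ n := (Nat.le_of_dvd (by omega) h2).trans_lt (by omega)
    have h4 : s < n := (Nat.pow_lt_pow_iff_right hp.out.one_lt).1 h3
    refine hy ?_
    rw [← QuotientGroup.eq_one_iff, QuotientGroup.mk_pow]
    exact orderOf_dvd_iff_pow_eq_one.1 (hs ▸ pow_dvd_pow p h4.le)
  refine Nat.card_le_card_of_injective (fun x => (⟨y ^ x.1.1 * x.2.1,
    mul_mem (pow_mem hyc _) x.2.2.2⟩ : Subgroup.centralizer {y})) ?_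
  rintro ⟨⟨i, hi⟩, a⟩ ⟨⟨j, hj⟩, b⟩ hxy
  have hxy : y ^ i * a.1 = y ^ j * b.1 := congrArg Subtype.val hxy
  have hnorm : A.Normal := inferInstance
  have h1 : y ^ i * (y ^ j)⁻¹ ∈ A := by
    have : y ^ i * (y ^ j)⁻¹ = y ^ j * (b.1 * a.1⁻¹) * (y ^ j)⁻¹ := by
      rw [← mul_assoc, ← hxy]; group
    rw [this]
    exact hnorm.conj_mem _ (mul_mem b.2.1 (inv_mem a.2.1)) _
  have h2 : y ^ j * (y ^ i)⁻¹ ∈ A := by simpa using inv_mem h1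
  have hij : i = j := le_antisymm (key i j hi hj h1) (key j i hj hi h2)
  subst hij
  have : a.1 = b.1 := mul_left_cancel hxy
  simp [Subtype.ext this]

open scoped IsMulCommutative in
/-- A `p`-group with a large commutative normal subgroup has many conjugacy classes. -/
lemma IsPGroup.mul_le_card_conjClasses {p : ℕ} [hp : Fact p.Prime] [Finite G] (hG : IsPGroup p G)
    (A : Subgroup G) [A.Normal] [IsMulCommutative A] {v : ℕ} (hA : Nat.card A = p ^ v)
    {r L R : ℕ} (hr : 1 ≤ r) (hk : Nat.card (ConjClasses G) ≤ p ^ L) (hL : 1 ≤ L)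
    (hLR : 6 * r * (L * p ^ R) ≤ v) :
    p ^ r * v ≤ 2 * Nat.card (ConjClasses G) ∨
      R * v ≤ 24 * p * r * Nat.card (ConjClasses G) := by
  have := Fintype.ofFinite G
  let _ : DistribMulAction G (Additive A) := conjDistribMulAction A
  have hfix : ∀ (y : G) (a : A), y • Additive.ofMul a = Additive.ofMul a ↔
      a.1 ∈ Subgroup.centralizer {y} := by
    intro y a
    rw [Subgroup.mem_centralizer_singleton_iff]
    change Additive.ofMul (MulAut.conjNormal y a) = Additive.ofMul a ↔ _
    rw [Additive.ofMul.injective.eq_iff, Subtype.ext_iff, MulAut.conjNormal_apply,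
      mul_inv_eq_iff_eq_mul, eq_comm]
  have hker : ∀ y : G, Nat.card (smulSubSelf (Additive A) y).ker =
      Nat.card (A ⊓ Subgroup.centralizer {y} : Subgroup G) := by
    intro y
    refine Nat.card_congr ?_
    exact
      { toFun := fun x => ⟨x.1.toMul.1, x.1.toMul.2, (hfix y x.1.toMul).1 (sub_eq_zero.1 x.2)⟩
        invFun := fun x => ⟨Additive.ofMul ⟨x.1, x.2.1⟩,
          sub_eq_zero.2 ((hfix y ⟨x.1, x.2.1⟩).2 x.2.2)⟩
        left_inv := fun x => rfl
        right_inv := fun x => rfl }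
  refine mul_le_or_mul_le (A := Additive A) hG (v := v) hA
    (fun y => Nat.card (Subgroup.centralizer {y})) (fun y => ?_) ?_ hr hk hL hLR
    sum_card_centralizer
  · rw [hker]
    exact Nat.card_le_card_of_injective _ (Subgroup.inclusion_injective inf_le_right)
  · rintro y a ⟨x, hx⟩
    rw [hker]
    refine pow_mul_card_le_card_centralizer hG A y a fun hmem => hx ?_
    refine (hfix _ x.toMul).2 (Subgroup.mem_centralizer_singleton_iff.2 ?_)
    exact setLike_mul_comm x.toMul.2 hmem

end Conjugation

section LowerCentralSeries

variable {G : Type*} [Group G]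

lemma Subgroup.commutator_commutator_le_of_rotate {H₁ H₂ H₃ N : Subgroup G} [N.Normal]
    (h1 : ⁅⁅H₂, H₃⁆, H₁⁆ ≤ N) (h2 : ⁅⁅H₃, H₁⁆, H₂⁆ ≤ N) : ⁅⁅H₁, H₂⁆, H₃⁆ ≤ N := by
  have key : ∀ K : Subgroup G, K ≤ N ↔ K.map (QuotientGroup.mk' N) = ⊥ := by
    intro K
    rw [Subgroup.map_eq_bot_iff, QuotientGroup.ker_mk']
  rw [key] at h1 h2 ⊢
  simp only [Subgroup.map_commutator] at h1 h2 ⊢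
  exact Subgroup.commutator_commutator_eq_bot_of_rotate h1 h2

lemma Subgroup.commutator_lowerCentralSeries_le (i j : ℕ) :
    ⁅(⊤ : Subgroup G).lowerCentralSeries i, (⊤ : Subgroup G).lowerCentralSeries j⁆ ≤
      (⊤ : Subgroup G).lowerCentralSeries (i + j + 1) := by
  induction j generalizing i with
  | zero => exact le_rfl
  | succ j ih =>
    rw [Subgroup.commutator_comm, Subgroup.lowerCentralSeries_succ]
    refine Subgroup.commutator_commutator_le_of_rotate ?_ ?_
    · rw [Subgroup.commutator_comm ⊤, ← Subgroup.lowerCentralSeries_succ]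
      exact (ih (i + 1)).trans_eq (by congr 1; ring)
    · refine (Subgroup.commutator_mono (ih i) le_rfl).trans_eq ?_
      rw [← Subgroup.lowerCentralSeries_succ]
      congr 1

lemma IsPGroup.lowerCentralSeries_eq_bot {p : ℕ} [hp : Fact p.Prime] [Finite G] (hG : IsPGroup p G)
    {m : ℕ} (hm : Nat.card G = p ^ m) {n : ℕ} (hn : m ≤ n) :
    (⊤ : Subgroup G).lowerCentralSeries n = ⊥ := by
  obtain ⟨d, hd⟩ := Subgroup.nilpotent_iff_lowerCentralSeries.1 hG.isNilpotent
  have hstab : ∀ i, (⊤ : Subgroup G).lowerCentralSeries (i + 1) =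
      (⊤ : Subgroup G).lowerCentralSeries i → (⊤ : Subgroup G).lowerCentralSeries i = ⊥ := by
    intro i hi
    have h1 : ∀ k, (⊤ : Subgroup G).lowerCentralSeries (i + k) =
        (⊤ : Subgroup G).lowerCentralSeries i := by
      intro k
      induction k with
      | zero => rfl
      | succ k ih => rw [← add_assoc, Subgroup.lowerCentralSeries_succ, ih]; exact hi
    rw [eq_bot_iff, ← h1 d, ← hd]
    exact Subgroup.lowerCentralSeries_antitone _ (by omega)
  have h2 : ∀ i, (⊤ : Subgroup G).lowerCentralSeries i = ⊥ ∨
      Nat.card ((⊤ : Subgroup G).lowerCentralSeries i) * p ^ i ≤ p ^ m := by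
    intro i
    induction i with
    | zero => right; simp [hm]
    | succ i ih =>
      have hle : (⊤ : Subgroup G).lowerCentralSeries (i + 1) ≤
        (⊤ : Subgroup G).lowerCentralSeries i := Subgroup.lowerCentralSeries_antitone _ (by omega)
      rcases ih with ih | ih
      · left; rwa [ih, le_bot_iff] at hle
      · by_cases hi : (⊤ : Subgroup G).lowerCentralSeries (i + 1) =
          (⊤ : Subgroup G).lowerCentralSeries i
        · left; rw [hi, hstab i hi]
        · right
          have h3 := Subgroup.card_dvd_of_le hle
          obtain ⟨a, -, ha⟩ := (Nat.dvd_prime_pow hp.out).1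
            (hm ▸ Subgroup.card_subgroup_dvd_card ((⊤ : Subgroup G).lowerCentralSeries i))
          obtain ⟨b, -, hb⟩ := (Nat.dvd_prime_pow hp.out).1
            (hm ▸ Subgroup.card_subgroup_dvd_card ((⊤ : Subgroup G).lowerCentralSeries (i + 1)))
          have h4 : b < a := by
            refine (Nat.pow_dvd_pow_iff_le_right hp.out.one_lt).1 (ha ▸ hb ▸ h3) |>.lt_of_ne ?_
            rintro rfl
            exact hi (Subgroup.eq_of_le_of_card_ge hle (by rw [ha, hb]))
          rw [ha] at ih
          rw [hb]
          refine le_trans ?_ ih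
          rw [← pow_add, ← pow_add]
          exact Nat.pow_le_pow_right hp.out.pos (by omega)
  rcases h2 n with h | h
  · exact h
  · refine Subgroup.eq_bot_of_card_le _ ?_
    have h5 : p ^ m ≤ p ^ n := Nat.pow_le_pow_right hp.out.pos hn
    have h6 : 0 < p ^ n := Nat.pow_pos hp.out.pos
    nlinarith

lemma card_conjClasses_quotient_le [Finite G] (N : Subgroup G) [N.Normal] :
    Nat.card (ConjClasses (G ⧸ N)) ≤ Nat.card (ConjClasses G) :=
  have : Finite (ConjClasses G) := Quotient.finite _
  Nat.card_le_card_of_surjective _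
    (ConjClasses.map_surjective (f := QuotientGroup.mk' N) (QuotientGroup.mk'_surjective N))

lemma card_le_card_conjClasses_mul_index [Finite G] (A : Subgroup G) [IsMulCommutative A] :
    Nat.card A ≤ Nat.card (ConjClasses G) * A.index := by
  classical
  have := Fintype.ofFinite G
  have h1 : Nat.card A * Nat.card A ≤ Nat.card (ConjClasses G) * Nat.card G := by
    rw [← sum_card_centralizer]
    calc Nat.card A * Nat.card A = ∑ y ∈ Finset.univ.filter (· ∈ A), Nat.card A := by
          rw [Finset.sum_const, smul_eq_mul, Nat.card_eq_fintype_card (α := A),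
            Fintype.card_subtype]
      _ ≤ ∑ y ∈ Finset.univ.filter (· ∈ A), Nat.card (Subgroup.centralizer {y}) := by
          refine Finset.sum_le_sum fun y hy => ?_
          have hy : y ∈ A := by simpa using hy
          refine Nat.card_le_card_of_injective _ (Subgroup.inclusion_injective fun x hx => ?_)
          exact Subgroup.mem_centralizer_singleton_iff.2 (setLike_mul_comm hx hy)
      _ ≤ _ := Finset.sum_le_sum_of_subset (Finset.subset_univ _)
  rw [← A.card_mul_index] at h1
  have : 0 < Nat.card A := Nat.card_pos
  refine Nat.le_of_mul_le_mul_left (?_ : Nat.card A * _ ≤ Nat.card A * _) this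
  calc _ ≤ _ := h1
    _ = _ := by ring

/-- The logarithmic sizes of a sequence of commutative sections exhausting a `p`-group, and the
bounds on the number of conjugacy classes resulting from them. -/
lemma IsPGroup.exists_index_sequence {p : ℕ} [hp : Fact p.Prime] [Finite G] (hG : IsPGroup p G)
    {m L : ℕ} (hm : Nat.card G = p ^ m) (hk : Nat.card (ConjClasses G) ≤ p ^ L) (hL : 1 ≤ L) :
    ∃ b : ℕ → ℕ, b 0 = 0 ∧ (∀ s, b s ≤ b (s + 1)) ∧ (∀ s, b (s + 1) ≤ 2 * b s + L) ∧
      (∀ s, m < 2 ^ s → b s = m) ∧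
      ∀ s r R, 1 ≤ r → 6 * r * (L * p ^ R) ≤ b (s + 1) - b s →
        p ^ r * (b (s + 1) - b s) ≤ 2 * Nat.card (ConjClasses G) ∨
        R * (b (s + 1) - b s) ≤ 24 * p * r * Nat.card (ConjClasses G) := by
  set M : ℕ → Subgroup G := fun s => (⊤ : Subgroup G).lowerCentralSeries (2 ^ s - 1) with hM
  have hnorm : ∀ s, (M s).Normal := fun s => inferInstance
  have hb : ∀ s, ∃ n, (M s).index = p ^ n := fun s =>
    let ⟨n, _, h⟩ := (Nat.dvd_prime_pow hp.out).1 (hm ▸ (M s).index_dvd_card)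
    ⟨n, h⟩
  choose b hb using hb
  have hinj := Nat.pow_right_injective hp.out.two_le
  have hanti : ∀ s, M (s + 1) ≤ M s := fun s =>
    Subgroup.lowerCentralSeries_antitone _ (by
      have := Nat.pow_le_pow_right (n := 2) (by omega) (Nat.le_succ s)
      simp only [Nat.succ_eq_add_one] at this
      omega)
  have hmono : ∀ s, b s ≤ b (s + 1) := by
    intro s
    have := Subgroup.index_dvd_of_le (hanti s)
    rw [hb, hb] at this
    exact (Nat.pow_dvd_pow_iff_le_right hp.out.one_lt).1 this
  have hcomm : ∀ s, IsMulCommutative ((M s).map (QuotientGroup.mk' (M (s + 1)))) := by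
    intro s
    refine IsMulCommutative.of_setLike_mul_comm ?_
    rintro _ ⟨x, hx, rfl⟩ _ ⟨y, hy, rfl⟩
    rw [← commutatorElement_eq_one_iff_mul_comm, ← map_commutatorElement]
    refine (QuotientGroup.eq_one_iff _).2 ?_
    refine Subgroup.lowerCentralSeries_antitone _ ?_
      (Subgroup.commutator_lowerCentralSeries_le _ _ (Subgroup.commutator_mem_commutator hx hy))
    have := Nat.one_le_two_pow (n := s)
    rw [pow_succ]
    omega
  have hcard : ∀ s, Nat.card ((M s).map (QuotientGroup.mk' (M (s + 1)))) =
      p ^ (b (s + 1) - b s) := by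
    intro s
    have h1 := ((M s).map (QuotientGroup.mk' (M (s + 1)))).card_mul_index
    have h2 : Nat.card (G ⧸ M (s + 1)) = p ^ b (s + 1) := hb (s + 1)
    rw [Subgroup.index_map_eq _ (QuotientGroup.mk'_surjective _)
      (by rw [QuotientGroup.ker_mk']; exact hanti s), hb, h2] at h1
    refine Nat.eq_of_mul_eq_mul_right (Nat.pow_pos hp.out.pos (n := b s)) ?_
    rw [h1, ← pow_add, Nat.sub_add_cancel (hmono s)]
  refine ⟨b, ?_, hmono, ?_, ?_, ?_⟩
  · have := hb 0
    simp only [hM, pow_zero, Nat.sub_self, Subgroup.lowerCentralSeries_zero,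
      Subgroup.index_top] at this
    exact hinj (by simpa using this.symm)
  · intro s
    have := hcomm s
    have h1 := card_le_card_conjClasses_mul_index ((M s).map (QuotientGroup.mk' (M (s + 1))))
    rw [hcard, Subgroup.index_map_eq _ (QuotientGroup.mk'_surjective _)
      (by rw [QuotientGroup.ker_mk']; exact hanti s), hb] at h1
    have h2 : p ^ (b (s + 1) - b s) ≤ p ^ (L + b s) := by
      rw [pow_add]
      exact h1.trans (Nat.mul_le_mul_right _ ((card_conjClasses_quotient_le _).trans hk))
    have := (Nat.pow_le_pow_iff_right hp.out.one_lt).1 h2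
    omega
  · intro s hs
    have h1 : M s = ⊥ := hG.lowerCentralSeries_eq_bot hm (by omega)
    have h2 := hb s
    rw [h1, Subgroup.index_bot, hm] at h2
    exact hinj h2.symm
  · intro s r R hr hR
    have := hcomm s
    have hle := card_conjClasses_quotient_le (M (s + 1))
    have := (hG.to_quotient (M (s + 1))).mul_le_card_conjClasses _ (hcard s) hr (hle.trans hk) hL hR
    rcases this with h | h
    · exact Or.inl (h.trans (Nat.mul_le_mul_left _ hle))
    · exact Or.inr (h.trans (Nat.mul_le_mul_left _ hle))

end LowerCentralSeries

section Asymptotics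

lemma exists_le_mul_sub {b : ℕ → ℕ} {m L S u : ℕ} (h0 : b 0 = 0)
    (hmono : ∀ s, b s ≤ b (s + 1)) (hb : ∀ s, b (s + 1) ≤ 2 * b s + L) (hS : b S = m)
    (hSm : 2 ^ S ≤ 2 * m) (huS : u ≤ S) (hu : 4 * L ≤ 2 ^ u) :
    ∃ s, m ≤ 2 * u * (b (s + 1) - b s) := by
  have h1 : ∀ s, b s + L ≤ 2 ^ s * L := by
    intro s
    induction s with
    | zero => simp [h0]
    | succ s ih => have := hb s; rw [pow_succ]; nlinarith
  have h2 : 4 * b (S - u) ≤ 2 * m := by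
    have h3 := Nat.mul_le_mul_left (2 ^ (S - u)) hu
    rw [← pow_add, Nat.sub_add_cancel huS] at h3
    have h4 := h1 (S - u)
    nlinarith
  by_contra! hcon
  have h3 : ∀ i, 2 * u * b (S - u + i) ≤ 2 * u * b (S - u) + i * m ∧
      (0 < i → 2 * u * b (S - u + i) < 2 * u * b (S - u) + i * m) := by
    intro i
    induction i with
    | zero => simp
    | succ i ih =>
      have h4 := hcon (S - u + i)
      have h5 := hmono (S - u + i)
      rw [Nat.mul_sub] at h4
      have h6 : (i + 1) * m = i * m + m := by ring
      rw [← add_assoc, h6]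
      omega
  have h4 := (h3 u).2
  rw [Nat.sub_add_cancel huS, hS] at h4
  rcases Nat.eq_zero_or_pos u with rfl | hu0
  · have := hcon 0
    rw [Nat.sub_zero, hS] at h2
    omega
  · have h5 := h4 hu0
    have h6 : u * (4 * b (S - u)) ≤ u * (2 * m) := Nat.mul_le_mul_left _ h2
    nlinarith

lemma exists_forall_mul_sq_le_two_pow (K : ℕ) : ∃ u₀ : ℕ, ∀ u, u₀ ≤ u → K * u ^ 2 ≤ 2 ^ u := by
  have h := (tendsto_pow_const_div_const_pow_of_one_lt 2 (one_lt_two (α := ℝ))).const_mul (K : ℝ)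
  rw [mul_zero] at h
  obtain ⟨u₀, hu₀⟩ := Filter.eventually_atTop.1 (h.eventually (gt_mem_nhds zero_lt_one))
  refine ⟨u₀, fun u hu => ?_⟩
  have h1 := hu₀ u hu
  rw [← mul_div_assoc, div_lt_one (by positivity)] at h1
  exact_mod_cast h1.le

/-- The choice of parameters used to bound the number of conjugacy classes. -/
lemma exists_parameters {p c : ℕ} (hp2 : 2 ≤ p) (hc : 1 ≤ c) :
    ∃ M : ℕ, ∀ m, M ≤ m → m ≠ 0 ∧ ∃ L u R : ℕ, c * m < 2 ^ L ∧ 1 ≤ L ∧ 0 < u ∧ 4 * L ≤ 2 ^ u ∧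
      2 ^ u ≤ 2 * m ∧ 12 * u ^ 2 * (L * p ^ R) ≤ m ∧ 4 * u * c < 2 ^ u ∧
      48 * p * u ^ 2 * c < R := by
  obtain ⟨u₀, hu₀⟩ := exists_forall_mul_sq_le_two_pow (16 * (24 * c + 48 * p * p * c + p))
  refine ⟨2 ^ 2 ^ u₀, fun m hm => ?_⟩
  have hm0 : m ≠ 0 := by have := Nat.one_le_two_pow (n := 2 ^ u₀); omega
  have hcm : c * m ≠ 0 := Nat.mul_ne_zero (by omega) hm0
  obtain ⟨L, hL⟩ : ∃ L, L = Nat.log 2 (c * m) + 1 := ⟨_, rfl⟩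
  obtain ⟨u, hu⟩ : ∃ u, u = Nat.log 2 L + 3 := ⟨_, rfl⟩
  have hL1 : c * m < 2 ^ L := hL ▸ Nat.lt_pow_succ_log_self (by omega) _
  have hL2 : 2 ^ L ≤ 2 * (c * m) := by
    rw [hL, pow_succ']; exact Nat.mul_le_mul_left _ (Nat.pow_log_le_self 2 hcm)
  have hu1 : 4 * L < 2 ^ u := by
    have := Nat.lt_pow_succ_log_self (b := 2) (by omega) L
    have e : 2 ^ u = 4 * 2 ^ (Nat.log 2 L + 1) := by rw [hu]; ring
    rw [Nat.succ_eq_add_one] at this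
    omega
  have hu2 : 2 ^ u ≤ 8 * L := by
    have := Nat.pow_log_le_self 2 (x := L) (by omega)
    have e : 2 ^ u = 8 * 2 ^ (Nat.log 2 L) := by rw [hu]; ring
    omega
  have hu0 : u₀ ≤ u := by
    have h1 : 2 ^ u₀ ≤ Nat.log 2 (c * m) :=
      Nat.le_log_of_pow_le (by omega) (hm.trans (Nat.le_mul_of_pos_left _ hc))
    have h2 : u₀ ≤ Nat.log 2 L := Nat.le_log_of_pow_le (by omega) (by omega)
    omega
  have hL0 : 1 ≤ L := by omega
  have hu00 : 0 < u := by omega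
  have hu3 := hu₀ u hu0
  clear hu hL hu0 hu₀ hm
  obtain ⟨e, he⟩ : ∃ e, e = (24 * c + 48 * p * p * c + p) * u ^ 2 := ⟨_, rfl⟩
  have he16 : 16 * e ≤ 2 ^ u := by rw [he, ← mul_assoc]; exact hu3
  have hsq : u ≤ u ^ 2 := Nat.le_self_pow (by omega) u
  obtain ⟨R, hR⟩ : ∃ R, R = 48 * p * u ^ 2 * c + 1 := ⟨_, rfl⟩
  have hueq : u ≤ e := by
    rw [he]
    exact hsq.trans (Nat.le_mul_of_pos_left _ (by omega))
  have hmain : 12 * u ^ 2 * (L * p ^ R) ≤ m := by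
    have h1 : 24 * c * u ^ 2 ≤ 2 ^ (24 * c * u ^ 2) := Nat.lt_two_pow_self.le
    have h2 : p ^ R ≤ 2 ^ (p * R) := by
      rw [pow_mul]; exact Nat.pow_le_pow_left Nat.lt_two_pow_self.le _
    have h3 : L ≤ 2 ^ e := by
      have := Nat.pow_le_pow_right (n := 2) (by omega) hueq
      omega
    have h4 : 24 * c * u ^ 2 + p * R + e ≤ L := by
      have : 24 * c * u ^ 2 + p * R ≤ e := by
        have h5 : p ≤ p * u ^ 2 := Nat.le_mul_of_pos_right _ (Nat.pow_pos hu00)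
        have h6 : p * R = 48 * p * p * c * u ^ 2 + p := by rw [hR]; ring
        rw [he, add_mul, add_mul]
        omega
      omega
    have h5 : (24 * c * u ^ 2) * p ^ R * L ≤ 2 * (c * m) := by
      calc _ ≤ 2 ^ (24 * c * u ^ 2) * 2 ^ (p * R) * 2 ^ e :=
            Nat.mul_le_mul (Nat.mul_le_mul h1 h2) h3
        _ = 2 ^ (24 * c * u ^ 2 + p * R + e) := by rw [pow_add, pow_add]
        _ ≤ 2 ^ L := Nat.pow_le_pow_right (by omega) h4
        _ ≤ _ := hL2
    refine Nat.le_of_mul_le_mul_left (?_ : (2 * c) * _ ≤ (2 * c) * _) (by omega)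
    calc _ = (24 * c * u ^ 2) * p ^ R * L := by ring
      _ ≤ _ := h5
      _ = _ := by ring
  refine ⟨hm0, L, u, R, hL1, hL0, hu00, hu1.le, ?_, hmain, ?_, by omega⟩
  · have h1 : 4 * L ≤ 12 * u ^ 2 * (L * p ^ R) := by
      have h2 : 1 ≤ u ^ 2 := Nat.pow_pos hu00
      have h3 : L ≤ L * p ^ R := Nat.le_mul_of_pos_right _ (Nat.pow_pos (by omega))
      exact Nat.mul_le_mul (by omega) h3
    omega
  · have h5 : u * c ≤ u ^ 2 * c := Nat.mul_le_mul_right _ hsq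
    have h6 : c * u ^ 2 ≤ e := he ▸ Nat.mul_le_mul_right _ (by omega)
    have h7 : 0 < u * c := Nat.mul_pos hu00 hc
    have h8 : 4 * u * c = 4 * (u * c) := by ring
    rw [mul_comm c] at h6
    omega

/-- For a fixed prime `p`, the number of conjugacy classes of a group of order `p ^ m` grows faster
than any linear function of `m`. -/
theorem exists_forall_mul_lt_card_conjClasses (p : ℕ) [hp : Fact p.Prime] (c : ℕ) :
    ∃ M : ℕ, ∀ m, M ≤ m → ∀ (G : Type) [Group G] [Finite G], Nat.card G = p ^ m →
      c * m < Nat.card (ConjClasses G) := by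
  wlog hc : 1 ≤ c generalizing c
  · obtain ⟨M, hM⟩ := this 1 le_rfl
    refine ⟨M, fun m hm G _ _ hG => ?_⟩
    have := hM m hm G hG
    have h0 : c = 0 := by omega
    rw [h0]; omega
  have hp2 := hp.out.two_le
  obtain ⟨M, hM⟩ := exists_parameters hp2 hc
  refine ⟨M, fun m hm G _ _ hG => ?_⟩
  obtain ⟨hm0, L, u, R, hL1, hL0, hu0, hu1, hu2, hmain, hu3, hR⟩ := hM m hm
  by_contra! hk
  have hG' : IsPGroup p G := IsPGroup.of_card hG
  obtain ⟨b, h0, hmono, hb, hbm, hfin⟩ := hG'.exists_index_sequence hG (L := L)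
    (hk.trans (hL1.le.trans (Nat.pow_le_pow_left hp2 _))) hL0
  obtain ⟨s, hs⟩ := exists_le_mul_sub (S := Nat.log 2 m + 1) (u := u) h0 hmono hb
    (hbm _ (Nat.lt_pow_succ_log_self (by omega) _))
    (by rw [pow_succ']; exact Nat.mul_le_mul_left _ (Nat.pow_log_le_self 2 hm0))
    (by
      have : u - 1 ≤ Nat.log 2 m := by
        refine Nat.le_log_of_pow_le (by omega) ?_
        have e : 2 ^ u = 2 * 2 ^ (u - 1) := by rw [← pow_succ']; congr 1; omega
        omega
      omega) hu1
  set v := b (s + 1) - b s with hv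
  rcases hfin s u R (by omega) (by
    refine Nat.le_of_mul_le_mul_left (?_ : (2 * u) * _ ≤ (2 * u) * _) (by omega)
    refine le_trans (le_of_eq ?_) (hmain.trans hs)
    ring) with h | h
  · have h1 : p ^ u * m ≤ (4 * u * c) * m := by
      calc p ^ u * m ≤ p ^ u * (2 * u * v) := Nat.mul_le_mul_left _ hs
        _ = 2 * u * (p ^ u * v) := by ring
        _ ≤ 2 * u * (2 * (c * m)) := by
            exact Nat.mul_le_mul_left _ (h.trans (Nat.mul_le_mul_left _ hk))
        _ = _ := by ring
    have h2 := Nat.le_of_mul_le_mul_right h1 (by omega)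
    have h3 : 2 ^ u ≤ p ^ u := Nat.pow_le_pow_left hp2 _
    omega
  · have h1 : R * m ≤ (48 * p * u ^ 2 * c) * m := by
      calc R * m ≤ R * (2 * u * v) := Nat.mul_le_mul_left _ hs
        _ = 2 * u * (R * v) := by ring
        _ ≤ 2 * u * (24 * p * u * (c * m)) := by
            exact Nat.mul_le_mul_left _ (h.trans (Nat.mul_le_mul_left _ hk))
        _ = _ := by ring
    have h2 := Nat.le_of_mul_le_mul_right h1 (by omega)
    omega

end Asymptotics

section Assembly

lemma IsPGroup.one_add_mul_le_card_conjClasses {p : ℕ} [hp : Fact p.Prime] {m : ℕ} {G : Type*}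
    [Group G] [Finite G] (hG : Nat.card G = p ^ m) :
    1 + m * (p - 1) ≤ Nat.card (ConjClasses G) := by
  induction m generalizing G with
  | zero =>
    have : Finite (ConjClasses G) := Quotient.finite _
    have := Nat.card_pos (α := ConjClasses G)
    omega
  | succ m ih =>
    have hfin : Finite (ConjClasses G) := Quotient.finite _
    have hpG : IsPGroup p G := IsPGroup.of_card hG
    have hnt : Nontrivial G := by
      rw [← Finite.one_lt_card_iff_nontrivial, hG]
      exact Nat.one_lt_pow (by omega) hp.out.one_lt
    have := hpG.center_nontrivial
    obtain ⟨z, hz⟩ : ∃ z : Subgroup.center G, orderOf z = p := by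
      refine exists_prime_orderOf_dvd_card' p ?_
      obtain ⟨n, hn⟩ := (hpG.to_subgroup (Subgroup.center G)).exists_card_eq
      rw [hn]
      refine dvd_pow_self p ?_
      rintro rfl
      rw [pow_zero] at hn
      exact (Finite.one_lt_card (α := Subgroup.center G)).ne' hn
    let Z := Subgroup.zpowers z.1
    have hZc : Z ≤ Subgroup.center G := (Subgroup.zpowers_le).2 z.2
    have hZn : Z.Normal := ⟨fun n hn g => by
      rwa [Subgroup.mem_center_iff.1 (hZc hn) g, mul_inv_cancel_right]⟩
    have hZcard : Nat.card Z = p := by rw [Nat.card_zpowers, Subgroup.orderOf_coe, hz]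
    have hQ : Nat.card (G ⧸ Z) = p ^ m := by
      have h1 := Z.card_mul_index
      rw [hZcard, hG, pow_succ'] at h1
      exact Nat.eq_of_mul_eq_mul_left hp.out.pos h1
    have hfinQ : Finite (ConjClasses (G ⧸ Z)) := Quotient.finite _
    have hih := ih hQ
    let f := ConjClasses.map (QuotientGroup.mk' Z)
    have hf : Function.Surjective f := ConjClasses.map_surjective (QuotientGroup.mk'_surjective Z)
    let g : {x : ConjClasses (G ⧸ Z) // x ≠ 1} ⊕ Z → ConjClasses G :=
      Sum.elim (fun x => Function.surjInv hf x.1) (fun z => ConjClasses.mk z.1)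
    have hfz : ∀ z : Z, f (ConjClasses.mk z.1) = 1 := by
      intro z
      exact congrArg ConjClasses.mk ((QuotientGroup.eq_one_iff z.1).2 z.2)
    have hg : Function.Injective g := by
      rintro (x | x) (y | y) hxy
      · have h1 := congrArg f hxy
        simp only [g, Sum.elim_inl, Function.surjInv_eq] at h1
        rw [Subtype.ext h1]
      · have h1 := congrArg f hxy
        simp only [g, Sum.elim_inl, Sum.elim_inr, Function.surjInv_eq, hfz] at h1
        exact absurd h1 x.2
      · have h1 := congrArg f hxy
        simp only [g, Sum.elim_inl, Sum.elim_inr, Function.surjInv_eq, hfz] at h1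
        exact absurd h1.symm y.2
      · have h1 : IsConj x.1 y.1 := ConjClasses.mk_eq_mk_iff_isConj.1 hxy
        obtain ⟨c, hc⟩ := isConj_iff.1 h1
        rw [Subgroup.mem_center_iff.1 (hZc x.2) c, mul_inv_cancel_right] at hc
        rw [Subtype.ext hc]
    have h2 := Nat.card_le_card_of_injective g hg
    have h3 : Nat.card {x : ConjClasses (G ⧸ Z) // x ≠ 1} = Nat.card (ConjClasses (G ⧸ Z)) - 1 := by
      classical
      have := Fintype.ofFinite (ConjClasses (G ⧸ Z))
      rw [Nat.card_eq_fintype_card, Nat.card_eq_fintype_card]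
      exact Set.card_ne_eq 1
    rw [Nat.card_sum, hZcard, h3] at h2
    have := hp.out.pos
    have h4 : (m + 1) * (p - 1) = m * (p - 1) + (p - 1) := by ring
    omega

lemma Group.IsNilpotent.prod_card_conjClasses_sylow_le {G : Type*} [Group G] [Finite G]
    (hG : Group.IsNilpotent G) (P : ∀ q : ℕ, Sylow q G) :
    ∏ q ∈ (Nat.card G).primeFactors, Nat.card (ConjClasses (P q)) ≤ Nat.card (ConjClasses G) := by
  classical
  have hfin : Finite (ConjClasses G) := Quotient.finite _
  obtain ⟨e⟩ := ((Group.isNilpotent_of_finite_tfae (G := G)).out 0 4 rfl rfl).1 hG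
  have huniq : ∀ (q : (Nat.card G).primeFactors) (P' : Sylow q G), P q = P' := by
    intro q P'
    have := Fact.mk (Nat.prime_of_mem_primeFactors q.2)
    have hn : (P q).Normal :=
      ((Group.isNilpotent_of_finite_tfae (G := G)).out 0 3 rfl rfl).1 hG q this (P q)
    exact (Sylow.unique_of_normal (P q) hn).instSubsingleton.elim _ _
  let φ : ∀ q : (Nat.card G).primeFactors, G →* P q := fun q =>
    (Pi.evalMonoidHom _ (P q)).comp ((Pi.evalMonoidHom _ q).comp e.symm.toMonoidHom)
  have hφ : ∀ x : (∀ q : (Nat.card G).primeFactors, P q), ∃ g : G, ∀ q, φ q g = x q := by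
    intro x
    refine ⟨e fun q P' => ⟨(x q).1, huniq q P' ▸ (x q).2⟩, fun q => Subtype.ext ?_⟩
    simp [φ]
  have hs : Function.Surjective (fun (c : ConjClasses G) (q : (Nat.card G).primeFactors) =>
      ConjClasses.map (φ q) c) := by
    intro y
    choose x hx using fun q => ConjClasses.exists_rep (y q)
    obtain ⟨g, hg⟩ := hφ x
    refine ⟨ConjClasses.mk g, funext fun q => ?_⟩
    rw [← hx q, ← hg q]
    rfl
  have h := Nat.card_le_card_of_surjective _ hs
  rw [Nat.card_pi] at h
  rw [← Finset.prod_coe_sort]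
  exact h

/-- `k(G)/d(|G|) → ∞` as `|G| → ∞` over finite nilpotent groups `G`: for every
real `C > 0` there exists `N` such that every finite nilpotent group `G` with
`|G| ≥ N` has more than `C · d(|G|)` conjugacy classes, where `d(n)` is the
number of divisors of `n`. -/
theorem conjClasses_div_divisors_tendsto_atTop (C : ℝ) (hC : 0 < C) :
    ∃ N : ℕ, ∀ (G : Type) [Group G] [Finite G], Group.IsNilpotent G →
      N ≤ Nat.card G →
      C * ((Nat.card G).divisors.card : ℝ) < (Nat.card (ConjClasses G) : ℝ) := by
  obtain ⟨D, hD⟩ := exists_nat_ge C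
  have hD1 : 1 ≤ D := by
    have : (0 : ℝ) < D := hC.trans_le hD
    exact_mod_cast this
  have hM : ∀ q : ℕ, ∃ M : ℕ, q.Prime → ∀ m, M ≤ m → ∀ (G : Type) [Group G] [Finite G],
      Nat.card G = q ^ m → 2 * D * m < Nat.card (ConjClasses G) := by
    intro q
    by_cases hq : q.Prime
    · have := Fact.mk hq
      exact (exists_forall_mul_lt_card_conjClasses q (2 * D)).imp fun M hM _ => hM
    · exact ⟨0, fun h => absurd h hq⟩
  choose M hM using hM
  refine ⟨∏ q ∈ (Finset.range (2 * D + 1)).filter Nat.Prime, q ^ M q + 1, fun G _ _ hG hN => ?_⟩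
  have hn0 : Nat.card G ≠ 0 := Nat.card_pos.ne'
  set n := Nat.card G with hn
  let P : ∀ q : ℕ, Sylow q G := fun q => default
  have hPcard : ∀ q ∈ n.primeFactors, Nat.card (P q) = q ^ n.factorization q := by
    intro q hq
    have := Fact.mk (Nat.prime_of_mem_primeFactors hq)
    exact (P q).card_eq_multiplicity
  have hle : ∀ q ∈ n.primeFactors, n.factorization q + 1 ≤ Nat.card (ConjClasses (P q)) := by
    intro q hq
    have hp := Nat.prime_of_mem_primeFactors hq
    have := Fact.mk hp
    have h1 := IsPGroup.one_add_mul_le_card_conjClasses (hPcard q hq)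
    have h2 : n.factorization q ≤ n.factorization q * (q - 1) :=
      Nat.le_mul_of_pos_right _ (by have := hp.two_le; omega)
    omega
  obtain ⟨q, hq, hlt⟩ : ∃ q ∈ n.primeFactors,
      D * (n.factorization q + 1) < Nat.card (ConjClasses (P q)) := by
    obtain ⟨q, hq, h⟩ : ∃ q ∈ n.primeFactors, 2 * D < q ∨ M q ≤ n.factorization q := by
      by_contra! hcon
      have h1 : n ≤ ∏ q ∈ (Finset.range (2 * D + 1)).filter Nat.Prime, q ^ M q := by
        calc n = ∏ q ∈ n.primeFactors, q ^ n.factorization q :=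
              (Nat.prod_factorization_pow_eq_self hn0).symm
          _ ≤ ∏ q ∈ n.primeFactors, q ^ M q := Finset.prod_le_prod' fun q hq =>
              Nat.pow_le_pow_right (Nat.prime_of_mem_primeFactors hq).pos (hcon q hq).2.le
          _ ≤ _ := by
              refine Finset.prod_le_prod_of_subset_of_one_le' (fun q hq => ?_) fun q hq _ => ?_
              · simp only [Finset.mem_filter, Finset.mem_range]
                exact ⟨by have := (hcon q hq).1; omega, Nat.prime_of_mem_primeFactors hq⟩
              · exact Nat.pow_pos (Finset.mem_filter.1 hq).2.pos
      omega
    refine ⟨q, hq, ?_⟩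
    have hp := Nat.prime_of_mem_primeFactors hq
    have := Fact.mk hp
    have hf : 1 ≤ n.factorization q :=
      hp.factorization_pos_of_dvd hn0 (Nat.dvd_of_mem_primeFactors hq)
    have h2 : D * (n.factorization q + 1) ≤ 2 * D * n.factorization q := by nlinarith
    rcases h with h | h
    · have h1 := IsPGroup.one_add_mul_le_card_conjClasses (hPcard q hq)
      have h3 : n.factorization q * (2 * D) ≤ n.factorization q * (q - 1) :=
        Nat.mul_le_mul_left _ (by omega)
      rw [mul_comm (2 * D)] at h2
      omega
    · exact h2.trans_lt (hM q hp _ h (P q) (hPcard q hq))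
  have hprod : D * n.divisors.card < Nat.card (ConjClasses G) := by
    refine lt_of_lt_of_le ?_ (hG.prod_card_conjClasses_sylow_le P)
    rw [Nat.card_divisors hn0, ← Finset.mul_prod_erase _ _ hq, ← Finset.mul_prod_erase _ _ hq,
      ← mul_assoc]
    have h1 : ∏ x ∈ n.primeFactors.erase q, (n.factorization x + 1) ≤
        ∏ x ∈ n.primeFactors.erase q, Nat.card (ConjClasses (P x)) :=
      Finset.prod_le_prod' fun x hx => hle x (Finset.mem_of_mem_erase hx)
    have h2 : 0 < ∏ x ∈ n.primeFactors.erase q, (n.factorization x + 1) :=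
      Finset.prod_pos fun _ _ => by omega
    calc _ < Nat.card (ConjClasses (P q)) * ∏ x ∈ n.primeFactors.erase q, (n.factorization x + 1) :=
          Nat.mul_lt_mul_of_pos_right hlt h2
      _ ≤ _ := Nat.mul_le_mul_left _ h1
  calc C * (n.divisors.card : ℝ) ≤ D * (n.divisors.card : ℝ) := by gcongr
    _ < _ := by exact_mod_cast hprod

end Assembly
end
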